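/- arXiv:2002.11239 — 8 statements merged into one kernel-verified Lean document; each statement's English description precedes it below -/
import Mathlib

section
/- Let x₀ ≥ 0 and let f, g be positive differentiable functions on [x₀,∞) whose derivatives satisfy f'(x) → 0 and g'(x) → 0 as x → ∞. Then the function h := f·g/(f+g) is differentiable on [x₀,∞) with h'(x) → 0 as x → ∞, and moreover k₁·exp(−∫_{x₀}^x du/f(u)) · k₂·exp(−∫_{x₀}^x du/g(u)) = k₁k₂·exp(−∫_{x₀}^x du/h(u)) for all x > x₀ and any constants k₁, k₂ > 0. Consequently, if F̄ and Ḡ are von Mises distribution tails with auxiliary functions f and g, then H̄ = F̄·Ḡ is a von Mises distribution tail with auxiliary function h. -/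
open Filter Real

/-- If `f` and `g` are positive differentiable auxiliary functions on `[x₀,∞)`
with derivatives tending to `0`, then `h = f*g/(f+g)` is differentiable on `[x₀,∞)` with
derivative tending to `0`, and the product of the two von Mises tails
`k₁ exp(-∫_{x₀}^x 1/f)` and `k₂ exp(-∫_{x₀}^x 1/g)` equals `k₁k₂ exp(-∫_{x₀}^x 1/h)`.
Hence the product of two von Mises distribution tails is a von Mises distribution tail with
auxiliary function `h`. -/
theorem product_of_vonMises_tails_is_vonMises
    (x₀ : ℝ) (hx₀ : 0 ≤ x₀) (f g : ℝ → ℝ)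
    (hf_pos : ∀ x, x₀ ≤ x → 0 < f x) (hg_pos : ∀ x, x₀ ≤ x → 0 < g x)
    (hf_diff : ∀ x, x₀ ≤ x → DifferentiableAt ℝ f x)
    (hg_diff : ∀ x, x₀ ≤ x → DifferentiableAt ℝ g x)
    (hf' : Tendsto (deriv f) atTop (nhds 0))
    (hg' : Tendsto (deriv g) atTop (nhds 0))
    (k₁ k₂ : ℝ) (hk₁ : 0 < k₁) (hk₂ : 0 < k₂) :
    (∀ x, x₀ ≤ x → DifferentiableAt ℝ (fun u => f u * g u / (f u + g u)) x) ∧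
    Tendsto (deriv (fun u => f u * g u / (f u + g u))) atTop (nhds 0) ∧
    (∀ x, x₀ < x →
      (k₁ * Real.exp (-∫ u in x₀..x, 1 / f u)) * (k₂ * Real.exp (-∫ u in x₀..x, 1 / g u))
        = k₁ * k₂ * Real.exp (-∫ u in x₀..x, 1 / (f u * g u / (f u + g u)))) := by
  have hD : ∀ x, x₀ ≤ x → HasDerivAt (fun u => f u * g u / (f u + g u))
      (deriv f x * (g x / (f x + g x)) ^ 2 + deriv g x * (f x / (f x + g x)) ^ 2) x := by
    intro x hx
    have hf := hf_pos x hx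
    have hg := hg_pos x hx
    have hne : f x + g x ≠ 0 := by positivity
    have h1 := (hf_diff x hx).hasDerivAt
    have h2 := (hg_diff x hx).hasDerivAt
    have h3 := (h1.mul h2).div (h1.add h2) hne
    refine h3.congr_deriv ?_
    simp only [Pi.mul_apply, Pi.add_apply]
    field_simp
    ring
  refine ⟨fun x hx => (hD x hx).differentiableAt, ?_, ?_⟩
  · have hlim : Tendsto (fun x => |deriv f x| + |deriv g x|) atTop (nhds 0) := by
      simpa using hf'.abs.add hg'.abs
    refine squeeze_zero_norm' ?_ hlim
    filter_upwards [eventually_ge_atTop x₀] with x hx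
    have hf := hf_pos x hx
    have hg := hg_pos x hx
    rw [(hD x hx).deriv, Real.norm_eq_abs]
    have ha : (g x / (f x + g x)) ^ 2 ≤ 1 :=
      pow_le_one₀ (by positivity) ((div_le_one (by positivity)).2 (by linarith))
    have hb : (f x / (f x + g x)) ^ 2 ≤ 1 :=
      pow_le_one₀ (by positivity) ((div_le_one (by positivity)).2 (by linarith))
    refine (abs_add_le _ _).trans (add_le_add ?_ ?_)
    · rw [abs_mul, abs_of_nonneg (sq_nonneg (g x / (f x + g x)))]
      exact mul_le_of_le_one_right (abs_nonneg _) ha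
    · rw [abs_mul, abs_of_nonneg (sq_nonneg (f x / (f x + g x)))]
      exact mul_le_of_le_one_right (abs_nonneg _) hb
  · intro x hx
    have key : ∀ p : ℝ → ℝ, (∀ x, x₀ ≤ x → 0 < p x) →
        (∀ x, x₀ ≤ x → DifferentiableAt ℝ p x) →
        IntervalIntegrable (fun u => 1 / p u) MeasureTheory.volume x₀ x := by
      intro p hp hd
      apply ContinuousOn.intervalIntegrable
      rw [Set.uIcc_of_le hx.le]
      intro u hu
      exact (continuousAt_const.div (hd u hu.1).continuousAt
        (hp u hu.1).ne').continuousWithinAt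
    have hI : ∫ u in x₀..x, 1 / (f u * g u / (f u + g u))
        = (∫ u in x₀..x, 1 / f u) + ∫ u in x₀..x, 1 / g u := by
      rw [← intervalIntegral.integral_add (key f hf_pos hf_diff) (key g hg_pos hg_diff)]
      apply intervalIntegral.integral_congr
      intro u hu
      rw [Set.uIcc_of_le hx.le] at hu
      have hf := hf_pos u hu.1
      have hg := hg_pos u hu.1
      simp only
      field_simp
      ring
    rw [hI, neg_add, Real.exp_add]
    ring
end

section
/- There exists a non-decreasing function U : (0,∞) → (0,∞) such that 1/(1−G(x)) = U(1/(1−F(x))) for all x > x₀, and U is regularly varying at infinity with index κ: for every λ > 0, U(λt)/U(t) → λ^κ as t → ∞ (in particular, U is slowly varying when κ = 0). -/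
open Filter Real

/-- Time change lemma. -/
theorem time_change_aux (φ ψ : ℝ → ℝ) (x₀ κ : ℝ) (hφ : Continuous φ) (hψ : Continuous ψ)
    (hφp : ∀ x, 0 < φ x) (hψp : ∀ x, 0 < ψ x)
    (hA : Tendsto (fun x => ∫ u in x₀..x, φ u) atTop atTop)
    (hκ : Tendsto (fun x => ψ x / φ x) atTop (nhds κ)) :
    ∃ V : ℝ → ℝ, Monotone V ∧
      (∀ x, x₀ ≤ x → V (∫ u in x₀..x, φ u) = ∫ u in x₀..x, ψ u) ∧
      ∀ c : ℝ, Tendsto (fun s => V (s + c) - V s) atTop (nhds (c * κ)) := by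
  set A : ℝ → ℝ := fun x => ∫ u in x₀..x, φ u with hAdef
  set B : ℝ → ℝ := fun x => ∫ u in x₀..x, ψ u with hBdef
  have dA : ∀ x, HasDerivAt A (φ x) x := fun x => hφ.integral_hasStrictDerivAt x₀ x |>.hasDerivAt
  have dB : ∀ x, HasDerivAt B (ψ x) x := fun x => hψ.integral_hasStrictDerivAt x₀ x |>.hasDerivAt
  have mA : StrictMono A := strictMono_of_deriv_pos fun x => by rw [(dA x).deriv]; exact hφp x
  have mB : StrictMono B := strictMono_of_deriv_pos fun x => by rw [(dB x).deriv]; exact hψp x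
  have cA : Continuous A := continuous_iff_continuousAt.2 fun x => (dA x).continuousAt
  have A0 : A x₀ = 0 := by simp [hAdef]
  have hex : ∀ s : ℝ, ∃ x, x₀ ≤ x ∧ A x = max s 0 := by
    intro s
    obtain ⟨y, hy, hy0⟩ := ((hA.eventually_ge_atTop (max s 0)).and (eventually_ge_atTop x₀)).exists
    obtain ⟨x, hx, hxe⟩ := intermediate_value_Icc hy0 cA.continuousOn
      (show max s 0 ∈ Set.Icc (A x₀) (A y) from ⟨by rw [A0]; exact le_max_right _ _, hy⟩)
    exact ⟨x, hx.1, hxe⟩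
  choose v hv0 hv using hex
  refine ⟨fun s => B (v s), ?_, ?_, ?_⟩
  · intro s t hst
    apply mB.monotone
    rw [← mA.le_iff_le, hv, hv]
    exact max_le_max_right _ hst
  · intro x hx
    have h0 : 0 ≤ A x := by rw [← A0]; exact mA.monotone hx
    have : v (A x) = x := mA.injective (by rw [hv, max_eq_left h0])
    change B (v (A x)) = B x
    rw [this]
  · intro c
    have hvt : Tendsto v atTop atTop := by
      rw [tendsto_atTop]
      intro X
      filter_upwards [eventually_ge_atTop (A X)] with s hs
      rw [← mA.le_iff_le, hv]
      exact hs.trans (le_max_left _ _)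
    rw [Metric.tendsto_atTop']
    intro ε hε
    set δ := ε / (|c| + 1) with hδ
    have hc1 : 0 < |c| + 1 := by positivity
    have hδp : 0 < δ := by positivity
    obtain ⟨X, hX⟩ := (Metric.tendsto_atTop.1 hκ) δ hδp
    have key : ∀ x y, X ≤ x → x ≤ y → |B y - B x - κ * (A y - A x)| ≤ δ * (A y - A x) := by
      intro x y hx hxy
      rcases hxy.eq_or_lt with rfl | hlt
      · simp
      obtain ⟨z, hz, he⟩ := exists_ratio_hasDerivAt_eq_ratio_slope B ψ hlt
        (fun w _ => (dB w).continuousAt.continuousWithinAt) (fun w _ => dB w)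
        A φ (fun w _ => (dA w).continuousAt.continuousWithinAt) (fun w _ => dA w)
      have h1 := hX z (hx.trans hz.1.le)
      rw [Real.dist_eq] at h1
      have hAp : 0 < A y - A x := sub_pos.2 (mA hlt)
      have h2 : B y - B x = (A y - A x) * (ψ z / φ z) := by
        have := (hφp z).ne'
        field_simp
        linarith
      rw [h2, show (A y - A x) * (ψ z / φ z) - κ * (A y - A x)
        = (ψ z / φ z - κ) * (A y - A x) by ring, abs_mul, abs_of_pos hAp]
      exact mul_le_mul_of_nonneg_right h1.le hAp.le
    have hev : ∀ᶠ s in atTop, dist (B (v (s + c)) - B (v s)) (c * κ) < ε := by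
      have hsc : Tendsto (fun s : ℝ => s + c) atTop atTop := tendsto_atTop_add_const_right _ _ tendsto_id
      filter_upwards [eventually_ge_atTop (0:ℝ), hsc.eventually_ge_atTop 0,
        hvt.eventually_ge_atTop X, (hvt.comp hsc).eventually_ge_atTop X] with s h1 h2 h3 h4
      have e1 : A (v s) = s := by rw [hv, max_eq_left h1]
      have e2 : A (v (s + c)) = s + c := by rw [hv, max_eq_left h2]
      have hb : |B (v (s + c)) - B (v s) - c * κ| ≤ δ * |c| := by
        rcases le_total (v s) (v (s + c)) with h | h
        · have := key _ _ h3 h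
          rw [e1, e2, add_sub_cancel_left] at this
          rw [mul_comm c]
          exact this.trans (mul_le_mul_of_nonneg_left (le_abs_self c) hδp.le)
        · have := key (v (s + c)) (v s) h4 h
          rw [e1, e2, show s - (s + c) = -c by ring] at this
          rw [← abs_neg, show -(B (v (s + c)) - B (v s) - c * κ)
            = B (v s) - B (v (s + c)) - κ * -c by ring]
          exact this.trans (mul_le_mul_of_nonneg_left (neg_le_abs c) hδp.le)
      rw [Real.dist_eq]
      refine hb.trans_lt ?_
      rw [hδ, div_mul_eq_mul_div, div_lt_iff₀ hc1]
      nlinarith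
    obtain ⟨N, hN⟩ := eventually_atTop.1 hev
    exact ⟨N, fun s hs => hN s hs.le⟩

/-- under the von Mises representations of the tails of `F` and `G` and the
balance condition `f/g → κ`, there is a non-decreasing function `U` on `(0,∞)` with
`1/(1-G(x)) = U(1/(1-F(x)))`, and `U` is regularly varying at infinity with index `κ`. -/
theorem exists_regularly_varying_U
    (F G : ℝ → ℝ) (x₀ k₁ k₂ κ : ℝ) (f g : ℝ → ℝ)
    (hx₀ : 0 ≤ x₀) (hk₁ : 0 < k₁) (hk₂ : 0 < k₂)
    (hFmono : Monotone F) (hGmono : Monotone G)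
    (hFcont : Continuous F) (hGcont : Continuous G)
    (hFneg : ∀ x, x < 0 → F x = 0) (hGneg : ∀ x, x < 0 → G x = 0)
    (hFtop : Filter.Tendsto F Filter.atTop (nhds 1))
    (hGtop : Filter.Tendsto G Filter.atTop (nhds 1))
    (hf_pos : ∀ x, x₀ ≤ x → 0 < f x) (hg_pos : ∀ x, x₀ ≤ x → 0 < g x)
    (hf_diff : ∀ x, x₀ ≤ x → DifferentiableAt ℝ f x)
    (hg_diff : ∀ x, x₀ ≤ x → DifferentiableAt ℝ g x)
    (hf' : Filter.Tendsto (deriv f) Filter.atTop (nhds 0))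
    (hg' : Filter.Tendsto (deriv g) Filter.atTop (nhds 0))
    (hFrep : ∀ x, x₀ < x → 1 - F x = k₁ * Real.exp (-∫ u in x₀..x, 1 / f u))
    (hGrep : ∀ x, x₀ < x → 1 - G x = k₂ * Real.exp (-∫ u in x₀..x, 1 / g u))
    (hκ : Filter.Tendsto (fun x => f x / g x) Filter.atTop (nhds κ)) (hκ0 : 0 ≤ κ) :
    ∃ U : ℝ → ℝ,
      MonotoneOn U (Set.Ioi 0) ∧
      (∀ t, 0 < t → 0 < U t) ∧
      (∀ x, x₀ < x → 1 / (1 - G x) = U (1 / (1 - F x))) ∧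
      (∀ l : ℝ, 0 < l →
        Filter.Tendsto (fun t => U (l * t) / U t) Filter.atTop (nhds (l ^ κ))) := by
  have hcont : ∀ p : ℝ → ℝ, (∀ x, x₀ ≤ x → 0 < p x) → (∀ x, x₀ ≤ x → DifferentiableAt ℝ p x) →
      Continuous (fun u => 1 / p (max u x₀)) := by
    intro p hp hd
    refine continuous_const.div (continuous_iff_continuousAt.2 fun u => ?_)
      fun u => (hp _ (le_max_right _ _)).ne'
    exact ContinuousAt.comp (g := p) (hd _ (le_max_right _ _)).continuousAt
      (continuous_id.max continuous_const).continuousAt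
  have hint : ∀ p : ℝ → ℝ, ∀ x, x₀ < x →
      ∫ u in x₀..x, 1 / p u = ∫ u in x₀..x, 1 / p (max u x₀) := by
    intro p x hx
    apply intervalIntegral.integral_congr
    intro u hu
    rw [Set.uIcc_of_le hx.le] at hu
    simp only [max_eq_left hu.1]
  have hAt : Tendsto (fun x => ∫ u in x₀..x, 1 / f (max u x₀)) atTop atTop := by
    rw [← tendsto_neg_atBot_iff, ← Real.tendsto_exp_comp_nhds_zero]
    have h : Tendsto (fun x => (1 - F x) / k₁) atTop (nhds 0) := by
      simpa using (hFtop.const_sub 1).div_const k₁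
    refine h.congr' ?_
    filter_upwards [eventually_gt_atTop x₀] with x hx
    rw [hFrep x hx, hint f x hx]
    field_simp
  obtain ⟨V, hVm, hVA, hVt⟩ := time_change_aux (fun u => 1 / f (max u x₀))
    (fun u => 1 / g (max u x₀)) x₀ κ (hcont f hf_pos hf_diff) (hcont g hg_pos hg_diff)
    (fun x => one_div_pos.2 (hf_pos _ (le_max_right _ _)))
    (fun x => one_div_pos.2 (hg_pos _ (le_max_right _ _))) hAt (by
      refine hκ.congr' ?_
      filter_upwards [eventually_ge_atTop x₀] with x hx
      simp only [max_eq_left hx]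
      have := (hf_pos x hx).ne'
      have := (hg_pos x hx).ne'
      field_simp)
  refine ⟨fun t => Real.exp (V (Real.log (k₁ * t))) / k₂, ?_, ?_, ?_, ?_⟩
  · intro s hs t ht hst
    have hs' : 0 < s := hs
    refine div_le_div_of_nonneg_right (Real.exp_le_exp.2 (hVm ?_)) hk₂.le
    exact Real.log_le_log (by positivity) (mul_le_mul_of_nonneg_left hst hk₁.le)
  · intro t ht
    positivity
  · intro x hx
    have e : Real.log (k₁ * (1 / (1 - F x))) = ∫ u in x₀..x, 1 / f (max u x₀) := by
      rw [hFrep x hx, hint f x hx, Real.exp_neg]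
      rw [show ∀ y : ℝ, k₁ * (1 / (k₁ * y⁻¹)) = y from fun y => by field_simp, Real.log_exp]
    simp only []
    rw [e, hVA x hx.le, hGrep x hx, hint g x hx, Real.exp_neg]
    field_simp
  · intro l hl
    have hlog : Tendsto (fun t => Real.log (k₁ * t)) atTop atTop :=
      Real.tendsto_log_atTop.comp (tendsto_id.const_mul_atTop hk₁)
    have h := (Real.continuous_exp.tendsto _).comp ((hVt (Real.log l)).comp hlog)
    rw [Real.rpow_def_of_pos hl]
    refine h.congr' ?_
    filter_upwards [eventually_gt_atTop (0:ℝ)] with t ht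
    have e : Real.log (k₁ * (l * t)) = Real.log (k₁ * t) + Real.log l := by
      rw [← Real.log_mul (by positivity) hl.ne']
      congr 1
      ring
    simp only [Function.comp]
    rw [e, Real.exp_sub]
    field_simp
end

section
/- For every κ with 0 ≤ κ < ∞: lim_{x→∞} (1/H̄(x)) · ∫_{(x,∞)} Ḡ(s) μ_F(ds) = 1/(1+κ), where μ_F is the Lebesgue–Stieltjes measure of F. Equivalently, the tail of the distribution of an uncensored lifetime, P[T_1 > x | T*_1 ≤ U_1] = (∫_{(x,∞)} Ḡ(s) μ_F(ds)) / (∫_{[0,∞)} Ḡ(s) μ_F(ds)), is asymptotically equivalent to H̄(x)/((1+κ)·p_u) as x → ∞, where p_u = ∫_{[0,∞)} Ḡ(s) μ_F(ds). -/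
open Filter Real MeasureTheory

/-- The measure of a half line. -/
lemma muF_Ioi (F : ℝ → ℝ)
    (hFtop : Filter.Tendsto F Filter.atTop (nhds 1)) (μF : Measure ℝ)
    (hμF : ∀ a b : ℝ, a ≤ b → μF (Set.Ioc a b) = ENNReal.ofReal (F b - F a)) (x : ℝ) :
    μF (Set.Ioi x) = ENNReal.ofReal (1 - F x) := by
  have h1 : Tendsto (fun y => μF (Set.Ioc x y)) atTop (nhds (μF (Set.Ioi x))) := by
    rw [← Set.iUnion_Ioc_right x]
    exact tendsto_measure_iUnion_atTop (fun a b hab => Set.Ioc_subset_Ioc_right hab)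
  have h2 : Tendsto (fun y => ENNReal.ofReal (F y - F x)) atTop
      (nhds (ENNReal.ofReal (1 - F x))) :=
    ENNReal.tendsto_ofReal (hFtop.sub_const _)
  refine tendsto_nhds_unique h1 (h2.congr' ?_)
  filter_upwards [eventually_ge_atTop x] with y hy
  rw [hμF x y hy]

/-- Derivative of a von Mises tail. -/
lemma vonMises_deriv (F f : ℝ → ℝ) (x₀ k : ℝ)
    (hf_pos : ∀ x, x₀ ≤ x → 0 < f x)
    (hf_diff : ∀ x, x₀ ≤ x → DifferentiableAt ℝ f x)
    (hFrep : ∀ x, x₀ < x → 1 - F x = k * Real.exp (-∫ u in x₀..x, 1 / f u))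
    (x : ℝ) (hx : x₀ < x) : HasDerivAt F ((1 - F x) / f x) x := by
  have hc : ContinuousOn (fun u => 1 / f u) (Set.Ici x₀) := fun u hu =>
    (continuousAt_const.div (hf_diff u hu).continuousAt (hf_pos u hu).ne').continuousWithinAt
  have hI : HasDerivAt (fun y => ∫ u in x₀..y, 1 / f u) (1 / f x) x := by
    apply intervalIntegral.integral_hasDerivAt_right
    · apply ContinuousOn.intervalIntegrable
      rw [Set.uIcc_of_le hx.le]
      exact hc.mono Set.Icc_subset_Ici_self
    · exact (hc.mono Set.Ioi_subset_Ici_self).stronglyMeasurableAtFilter isOpen_Ioi x hx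
    · exact hc.continuousAt (Ici_mem_nhds hx)
  have h2 : HasDerivAt (fun y => 1 - k * Real.exp (-∫ u in x₀..y, 1 / f u))
      ((1 - F x) / f x) x := by
    have := ((hI.neg.exp).const_mul k).const_sub 1
    refine this.congr_deriv ?_
    rw [hFrep x hx]
    simp only [Pi.neg_apply]
    ring
  refine h2.congr_of_eventuallyEq ?_
  filter_upwards [Ioi_mem_nhds hx] with y hy
  rw [← hFrep y hy]
  ring

/-- under the von Mises representations and the balance condition `f/g → κ`
(`0 ≤ κ < ∞`), the tail integral `∫_{(x,∞)} Ḡ dμ_F` is asymptotic to `H̄(x)/(1+κ)`,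
i.e. `(1/H̄(x)) ∫_{(x,∞)} Ḡ dμ_F → 1/(1+κ)` as `x → ∞`, where `μ_F` is the
Lebesgue–Stieltjes measure of `F` and `H̄ = F̄ Ḡ`. -/
theorem uncensored_tail_asymptotics
    (F G : ℝ → ℝ) (x₀ k₁ k₂ κ : ℝ) (f g : ℝ → ℝ)
    (hx₀ : 0 ≤ x₀) (hk₁ : 0 < k₁) (hk₂ : 0 < k₂)
    (hFmono : Monotone F) (hGmono : Monotone G)
    (hFcont : Continuous F) (hGcont : Continuous G)
    (hFneg : ∀ x, x < 0 → F x = 0) (hGneg : ∀ x, x < 0 → G x = 0)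
    (hFtop : Filter.Tendsto F Filter.atTop (nhds 1))
    (hGtop : Filter.Tendsto G Filter.atTop (nhds 1))
    (hf_pos : ∀ x, x₀ ≤ x → 0 < f x) (hg_pos : ∀ x, x₀ ≤ x → 0 < g x)
    (hf_diff : ∀ x, x₀ ≤ x → DifferentiableAt ℝ f x)
    (hg_diff : ∀ x, x₀ ≤ x → DifferentiableAt ℝ g x)
    (hf' : Filter.Tendsto (deriv f) Filter.atTop (nhds 0))
    (hg' : Filter.Tendsto (deriv g) Filter.atTop (nhds 0))
    (hFrep : ∀ x, x₀ < x → 1 - F x = k₁ * Real.exp (-∫ u in x₀..x, 1 / f u))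
    (hGrep : ∀ x, x₀ < x → 1 - G x = k₂ * Real.exp (-∫ u in x₀..x, 1 / g u))
    (hκ : Filter.Tendsto (fun x => f x / g x) Filter.atTop (nhds κ)) (hκ0 : 0 ≤ κ)
    (μF : Measure ℝ)
    (hμF : ∀ a b : ℝ, a ≤ b → μF (Set.Ioc a b) = ENNReal.ofReal (F b - F a)) :
    Filter.Tendsto
      (fun x => (∫ s in Set.Ioi x, (1 - G s) ∂μF) / ((1 - F x) * (1 - G x)))
      Filter.atTop (nhds (1 / (1 + κ))) := by
  have hG1 : ∀ x, G x ≤ 1 := fun x => hGmono.ge_of_tendsto hGtop x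
  have hF1 : ∀ x, F x ≤ 1 := fun x => hFmono.ge_of_tendsto hFtop x
  have hFd := vonMises_deriv F f x₀ k₁ hf_pos hf_diff hFrep
  have hGd := vonMises_deriv G g x₀ k₂ hg_pos hg_diff hGrep
  have hIoi := muF_Ioi F hFtop μF hμF
  have hint : ∀ x, IntegrableOn (fun s => 1 - G s) (Set.Ioi x) μF := by
    intro x
    refine Measure.integrableOn_of_bounded (M := 1 - G x) ?_ ?_ ?_
    · rw [hIoi]; exact ENNReal.ofReal_ne_top
    · exact (continuous_const.sub hGcont).aestronglyMeasurable
    · filter_upwards [ae_restrict_mem measurableSet_Ioi] with s hs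
      rw [Real.norm_of_nonneg (by linarith [hG1 s])]
      linarith [hGmono (le_of_lt hs)]
  set I : ℝ → ℝ := fun x => ∫ s in Set.Ioi x, (1 - G s) ∂μF with hI
  have hsplit : ∀ x y, x ≤ y → I x - I y = ∫ s in Set.Ioc x y, (1 - G s) ∂μF := by
    intro x y hxy
    have := setIntegral_union (μ := μF) (f := fun s => 1 - G s)
      (Set.Ioc_disjoint_Ioi_same (a := x) (b := y)) measurableSet_Ioi
      ((hint x).mono_set Set.Ioc_subset_Ioi_self) (hint y)
    rw [Set.Ioc_union_Ioi_eq_Ioi hxy] at this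
    simp only [hI]
    rw [this]; ring
  have hreal : ∀ x y, x ≤ y → μF.real (Set.Ioc x y) = F y - F x := by
    intro x y hxy
    rw [Measure.real, hμF x y hxy, ENNReal.toReal_ofReal (by linarith [hFmono hxy])]
  have hfin : ∀ x y, x ≤ y → μF (Set.Ioc x y) ≠ ⊤ := by
    intro x y hxy
    rw [hμF x y hxy]; exact ENNReal.ofReal_ne_top
  have hub : ∀ x y, x ≤ y → I x - I y ≤ (1 - G x) * (F y - F x) := by
    intro x y hxy
    rw [hsplit x y hxy, ← hreal x y hxy]
    have := setIntegral_mono_on (μ := μF) (f := fun s => 1 - G s) (g := fun _ => 1 - G x)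
      ((hint x).mono_set Set.Ioc_subset_Ioi_self) (integrableOn_const (hfin x y hxy))
      measurableSet_Ioc (fun s hs => by linarith [hGmono hs.1.le])
    rw [setIntegral_const, smul_eq_mul] at this
    linarith
  have hlb : ∀ x y, x ≤ y → (1 - G y) * (F y - F x) ≤ I x - I y := by
    intro x y hxy
    rw [hsplit x y hxy, ← hreal x y hxy]
    have := setIntegral_mono_on (μ := μF) (g := fun s => 1 - G s) (f := fun _ => 1 - G y)
      (integrableOn_const (hfin x y hxy)) ((hint x).mono_set Set.Ioc_subset_Ioi_self)
      measurableSet_Ioc (fun s hs => by linarith [hGmono hs.2])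
    rw [setIntegral_const, smul_eq_mul] at this
    linarith
  have hkey : ∀ x y, |I y - I x + (1 - G x) * (F y - F x)| ≤ |(G y - G x) * (F y - F x)| := by
    intro x y
    rcases le_total x y with h | h
    · have h1 := hub x y h
      have h2 := hlb x y h
      have h3 := mul_nonneg (sub_nonneg.2 (hGmono h)) (sub_nonneg.2 (hFmono h))
      rw [abs_of_nonneg h3, abs_le]
      constructor <;> nlinarith
    · have h1 := hub y x h
      have h2 := hlb y x h
      have h3 := mul_nonneg (sub_nonneg.2 (hGmono h)) (sub_nonneg.2 (hFmono h))
      rw [show (G y - G x) * (F y - F x) = (G x - G y) * (F x - F y) by ring,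
        abs_of_nonneg h3, abs_le]
      constructor <;> nlinarith
  have hId : ∀ x, x₀ < x → HasDerivAt I (-((1 - G x) * ((1 - F x) / f x))) x := by
    intro x hx
    have hJ : HasDerivAt (fun y => I y + (1 - G x) * F y) 0 x := by
      rw [hasDerivAt_iff_isLittleO]
      have hO : (fun y => F y - F x) =O[nhds x] (fun y => y - x) := (hFd x hx).isBigO_sub
      have ho : (fun y => G y - G x) =o[nhds x] (fun _ => (1 : ℝ)) := by
        rw [Asymptotics.isLittleO_one_iff]
        have := (hGcont.tendsto x).sub_const (G x)
        simpa using this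
      have hm := ho.mul_isBigO hO
      simp only [one_mul] at hm
      refine Asymptotics.IsBigO.trans_isLittleO (Asymptotics.IsBigO.of_bound 1 ?_) hm
      refine Eventually.of_forall fun y => ?_
      rw [one_mul, Real.norm_eq_abs, Real.norm_eq_abs]
      convert hkey x y using 2
      simp; ring
    have := hJ.sub ((hFd x hx).const_mul (1 - G x))
    refine (this.congr_deriv (by ring)).congr_of_eventuallyEq ?_
    exact Eventually.of_forall fun y => by simp
  have hFpos : ∀ x, x₀ < x → 0 < 1 - F x := fun x hx => by rw [hFrep x hx]; positivity
  have hGpos : ∀ x, x₀ < x → 0 < 1 - G x := fun x hx => by rw [hGrep x hx]; positivity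
  have hHd : ∀ x, x₀ < x → HasDerivAt (fun y => (1 - F y) * (1 - G y))
      (-((1 - F x) / f x) * (1 - G x) + (1 - F x) * (-((1 - G x) / g x))) x := fun x hx =>
    ((hFd x hx).const_sub 1).mul ((hGd x hx).const_sub 1)
  have hF0 : Tendsto (fun x => 1 - F x) atTop (nhds 0) := by
    simpa using hFtop.const_sub 1
  have hG0 : Tendsto (fun x => 1 - G x) atTop (nhds 0) := by
    simpa using hGtop.const_sub 1
  have hI0 : Tendsto I atTop (nhds 0) := by
    have hle : ∀ x, I x ≤ (1 - G x) * (1 - F x) := by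
      intro x
      have := setIntegral_mono_on (μ := μF) (f := fun s => 1 - G s) (g := fun _ => 1 - G x)
        (hint x) (integrableOn_const (by rw [hIoi]; exact ENNReal.ofReal_ne_top))
        measurableSet_Ioi (fun s hs => by linarith [hGmono (le_of_lt hs)])
      rw [setIntegral_const, smul_eq_mul, Measure.real, hIoi,
        ENNReal.toReal_ofReal (by linarith [hF1 x])] at this
      linarith
    refine squeeze_zero (fun x => ?_) hle (by simpa using hG0.mul hF0)
    exact integral_nonneg fun s => by simpa using hG1 s
  refine HasDerivAt.lhopital_zero_atTop
    (f' := fun x => -((1 - G x) * ((1 - F x) / f x)))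
    (g' := fun x => -((1 - F x) / f x) * (1 - G x) + (1 - F x) * (-((1 - G x) / g x)))
    ?_ ?_ ?_ hI0 (by simpa using hF0.mul hG0) ?_
  · filter_upwards [eventually_gt_atTop x₀] with x hx using hId x hx
  · filter_upwards [eventually_gt_atTop x₀] with x hx using hHd x hx
  · filter_upwards [eventually_gt_atTop x₀] with x hx
    have a := hFpos x hx
    have b := hGpos x hx
    have c := hf_pos x hx.le
    have d := hg_pos x hx.le
    have e : 0 < (1 - F x) / f x * (1 - G x) + (1 - F x) * ((1 - G x) / g x) := by positivity
    intro h0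
    nlinarith
  · have hlim : Tendsto (fun x => 1 / (1 + f x / g x)) atTop (nhds (1 / (1 + κ))) :=
      tendsto_const_nhds.div (hκ.const_add 1) (by positivity)
    refine hlim.congr' ?_
    filter_upwards [eventually_gt_atTop x₀] with x hx
    have a := hFpos x hx
    have b := hGpos x hx
    have c := hf_pos x hx.le
    have d := hg_pos x hx.le
    generalize 1 - F x = A at *
    generalize 1 - G x = B at *
    have h1 : -(A / f x) * B + A * -(B / g x) = -(A * B * (f x + g x) / (f x * g x)) := by
      field_simp
      ring
    rw [h1, neg_div_neg_eq]
    field_simp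
    try ring
end

section
/- Suppose κ = 0. Then lim_{x→∞} (1/H̄(x)) · ∫_{(x,∞)} F̄(s) μ_G(ds) = 0 and lim_{x→∞} (∫_{(x,∞)} F̄(s) μ_G(ds)) / (∫_{(x,∞)} Ḡ(s) μ_F(ds)) = 0, where μ_F and μ_G are the Lebesgue–Stieltjes measures of F and G. -/
open Filter Real MeasureTheory

lemma aux_deriv (F : ℝ → ℝ) (x₀ k : ℝ) (f : ℝ → ℝ)
    (hf_pos : ∀ x, x₀ ≤ x → 0 < f x)
    (hf_diff : ∀ x, x₀ ≤ x → DifferentiableAt ℝ f x)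
    (hFrep : ∀ x, x₀ < x → 1 - F x = k * Real.exp (-∫ u in x₀..x, 1 / f u))
    (x : ℝ) (hx : x₀ < x) : HasDerivAt F ((1 - F x) / f x) x := by
  have hc : ContinuousOn (fun u => 1 / f u) (Set.Ici x₀) := by
    intro y hy
    exact (continuousAt_const.div (hf_diff y hy).continuousAt (hf_pos y hy).ne').continuousWithinAt
  have h1 : HasDerivAt (fun y => ∫ u in x₀..y, 1 / f u) (1 / f x) x := by
    apply intervalIntegral.integral_hasDerivAt_right
    · apply ContinuousOn.intervalIntegrable
      rw [Set.uIcc_of_le hx.le]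
      exact hc.mono Set.Icc_subset_Ici_self
    · exact (hc.mono Set.Ioi_subset_Ici_self).stronglyMeasurableAtFilter isOpen_Ioi x hx
    · exact hc.continuousAt (Ici_mem_nhds hx)
  have h2 := (((h1.fun_neg).exp).const_mul k).const_sub 1
  have h3 : (fun y => 1 - k * Real.exp (-∫ u in x₀..y, 1 / f u)) =ᶠ[nhds x] F := by
    filter_upwards [Ioi_mem_nhds hx] with y hy
    rw [← hFrep y hy]; ring
  have h4 := h2.congr_of_eventuallyEq h3.symm
  have h5 : (1 - F x) / f x
      = -(k * (rexp (-∫ (u : ℝ) in x₀..x, 1 / f u) * -(1 / f x))) := by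
    rw [hFrep x hx]; ring
  rw [h5]
  exact h4

lemma aux_density (F : ℝ → ℝ) (x₀ k : ℝ) (f : ℝ → ℝ) (hk : 0 < k)
    (hFcont : Continuous F)
    (hf_pos : ∀ x, x₀ ≤ x → 0 < f x)
    (hf_diff : ∀ x, x₀ ≤ x → DifferentiableAt ℝ f x)
    (hFrep : ∀ x, x₀ < x → 1 - F x = k * Real.exp (-∫ u in x₀..x, 1 / f u))
    (μF : Measure ℝ)
    (hμF : ∀ a b : ℝ, a ≤ b → μF (Set.Ioc a b) = ENNReal.ofReal (F b - F a))
    (x : ℝ) (hx : x₀ < x) :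
    μF.restrict (Set.Ioi x) =
      (volume.restrict (Set.Ioi x)).withDensity (fun s => ENNReal.ofReal ((1 - F s) / f s)) := by
  have hlf : IsLocallyFiniteMeasure μF := by
    refine ⟨fun y => ⟨Set.Ioc (y - 1) (y + 1), Ioc_mem_nhds (by linarith) (by linarith), ?_⟩⟩
    rw [hμF _ _ (by linarith)]
    exact ENNReal.ofReal_lt_top
  apply Measure.ext_of_Ioc
  intro a b hab
  rw [Measure.restrict_apply measurableSet_Ioc, withDensity_apply _ measurableSet_Ioc,
    Measure.restrict_restrict measurableSet_Ioc, Set.Ioc_inter_Ioi]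
  rcases le_total b (max a x) with h | h
  · simp [Set.Ioc_eq_empty_of_le h]
  · rw [hμF _ _ h]
    set c := max a x
    have hc : x ≤ c := le_max_right _ _
    have hco : ContinuousOn (fun s => (1 - F s) / f s) (Set.Icc c b) := by
      intro y hy
      have hy' : x₀ ≤ y := by linarith [hy.1]
      exact ((continuousAt_const.sub hFcont.continuousAt).div (hf_diff y hy').continuousAt
        (hf_pos y hy').ne').continuousWithinAt
    have hii : IntervalIntegrable (fun s => (1 - F s) / f s) volume c b := by
      apply ContinuousOn.intervalIntegrable
      rwa [Set.uIcc_of_le h]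
    rw [← intervalIntegral.integral_eq_sub_of_hasDerivAt (f := F) (a := c) (b := b)
      (f' := fun s => (1 - F s) / f s) _ hii, intervalIntegral.integral_of_le h]
    · apply ofReal_integral_eq_lintegral_ofReal
      · exact (intervalIntegrable_iff_integrableOn_Ioc_of_le h).1 hii
      · filter_upwards [ae_restrict_mem measurableSet_Ioc] with y hy
        have hy' : x₀ < y := by linarith [hy.1]
        have := hf_pos y hy'.le
        simp only [hFrep y hy', Pi.zero_apply]
        positivity
    · intro y hy
      rw [Set.uIcc_of_le h] at hy
      exact aux_deriv F x₀ k f hf_pos hf_diff hFrep y (by linarith [hy.1])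

lemma aux_mass (F : ℝ → ℝ) (hFmono : Monotone F)
    (hFtop : Filter.Tendsto F Filter.atTop (nhds 1)) (μF : Measure ℝ)
    (hμF : ∀ a b : ℝ, a ≤ b → μF (Set.Ioc a b) = ENNReal.ofReal (F b - F a)) (x : ℝ) :
    μF (Set.Ioi x) ≤ ENNReal.ofReal (1 - F x) := by
  have h : Set.Ioi x = ⋃ n : ℕ, Set.Ioc x (x + n) := by
    ext y
    simp only [Set.mem_Ioi, Set.mem_iUnion, Set.mem_Ioc]
    constructor
    · intro hy
      obtain ⟨n, hn⟩ := exists_nat_ge (y - x)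
      exact ⟨n, hy, by linarith⟩
    · rintro ⟨n, h, _⟩
      exact h
  have hm : Monotone (fun n : ℕ => Set.Ioc x (x + n)) := by
    intro m n hmn
    apply Set.Ioc_subset_Ioc_right
    have : (m : ℝ) ≤ n := by exact_mod_cast hmn
    linarith
  rw [h, hm.measure_iUnion]
  apply iSup_le
  intro n
  rw [hμF _ _ (by simp)]
  apply ENNReal.ofReal_le_ofReal
  have := hFmono.ge_of_tendsto hFtop (x + n)
  linarith

lemma aux_integrable (F G : ℝ → ℝ) (hFmono : Monotone F) (hGmono : Monotone G)
    (hGcont : Continuous G)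
    (hFtop : Filter.Tendsto F Filter.atTop (nhds 1))
    (hGtop : Filter.Tendsto G Filter.atTop (nhds 1)) (μF : Measure ℝ)
    (hμF : ∀ a b : ℝ, a ≤ b → μF (Set.Ioc a b) = ENNReal.ofReal (F b - F a)) (x : ℝ) :
    IntegrableOn (fun s => 1 - G s) (Set.Ioi x) μF := by
  have hm := aux_mass F hFmono hFtop μF hμF x
  apply Measure.integrableOn_of_bounded (M := 1 - G x) (hm.trans_lt ENNReal.ofReal_lt_top).ne
  · exact (continuous_const.sub hGcont).aestronglyMeasurable
  · filter_upwards [ae_restrict_mem measurableSet_Ioi] with y hy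
    have h1 := hGmono.ge_of_tendsto hGtop y
    have h2 := hGmono (le_of_lt hy)
    rw [Real.norm_of_nonneg (by linarith)]
    linarith

lemma aux_integral (F G : ℝ → ℝ) (x₀ k : ℝ) (f : ℝ → ℝ) (hk : 0 < k)
    (hFmono : Monotone F) (hGmono : Monotone G)
    (hFcont : Continuous F) (hGcont : Continuous G)
    (hFtop : Filter.Tendsto F Filter.atTop (nhds 1))
    (hGtop : Filter.Tendsto G Filter.atTop (nhds 1))
    (hf_pos : ∀ x, x₀ ≤ x → 0 < f x)
    (hf_diff : ∀ x, x₀ ≤ x → DifferentiableAt ℝ f x)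
    (hFrep : ∀ x, x₀ < x → 1 - F x = k * Real.exp (-∫ u in x₀..x, 1 / f u))
    (μF : Measure ℝ)
    (hμF : ∀ a b : ℝ, a ≤ b → μF (Set.Ioc a b) = ENNReal.ofReal (F b - F a))
    (x : ℝ) (hx : x₀ < x) :
    IntegrableOn (fun s => (1 - F s) / f s * (1 - G s)) (Set.Ioi x) ∧
    ∫ s in Set.Ioi x, (1 - G s) ∂μF = ∫ s in Set.Ioi x, (1 - F s) / f s * (1 - G s) := by
  have hd := aux_density F x₀ k f hk hFcont hf_pos hf_diff hFrep μF hμF x hx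
  have hi := aux_integrable F G hFmono hGmono hGcont hFtop hGtop μF hμF x
  have hco : ContinuousOn (fun s => (1 - F s) / f s) (Set.Ioi x) := by
    intro y hy
    have hy' : x₀ ≤ y := (hx.trans hy).le
    exact ((continuousAt_const.sub hFcont.continuousAt).div (hf_diff y hy').continuousAt
      (hf_pos y hy').ne').continuousWithinAt
  have hae : AEMeasurable (fun s => ENNReal.ofReal ((1 - F s) / f s))
      (volume.restrict (Set.Ioi x)) := (hco.aemeasurable measurableSet_Ioi).ennreal_ofReal
  have hlt : ∀ᵐ s ∂(volume.restrict (Set.Ioi x)), ENNReal.ofReal ((1 - F s) / f s) < ⊤ :=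
    Eventually.of_forall fun s => ENNReal.ofReal_lt_top
  have heq : (fun s => (ENNReal.ofReal ((1 - F s) / f s)).toReal • (1 - G s))
      =ᵐ[volume.restrict (Set.Ioi x)] fun s => (1 - F s) / f s * (1 - G s) := by
    filter_upwards [ae_restrict_mem measurableSet_Ioi] with y hy
    have hy' : x₀ < y := hx.trans hy
    have := hf_pos y hy'.le
    rw [ENNReal.toReal_ofReal, smul_eq_mul]
    rw [hFrep y hy']
    positivity
  unfold IntegrableOn at hi ⊢
  rw [hd] at hi ⊢
  constructor
  · exact ((integrable_withDensity_iff_integrable_smul₀' hae hlt).1 hi).congr heq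
  · rw [integral_withDensity_eq_integral_toReal_smul₀ hae hlt]
    exact integral_congr_ae heq

/-- under the von Mises representations and the balance condition `f/g → 0`
(`κ = 0`), both `(1/H̄(x)) ∫_{(x,∞)} F̄ dμ_G → 0` and
`(∫_{(x,∞)} F̄ dμ_G) / (∫_{(x,∞)} Ḡ dμ_F) → 0` as `x → ∞`, where `μ_F`, `μ_G` are the
Lebesgue–Stieltjes measures of `F` and `G`, and `H̄ = F̄ Ḡ`. -/
theorem censored_tail_asymptotics_kappa_zero
    (F G : ℝ → ℝ) (x₀ k₁ k₂ : ℝ) (f g : ℝ → ℝ)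
    (hx₀ : 0 ≤ x₀) (hk₁ : 0 < k₁) (hk₂ : 0 < k₂)
    (hFmono : Monotone F) (hGmono : Monotone G)
    (hFcont : Continuous F) (hGcont : Continuous G)
    (hFneg : ∀ x, x < 0 → F x = 0) (hGneg : ∀ x, x < 0 → G x = 0)
    (hFtop : Filter.Tendsto F Filter.atTop (nhds 1))
    (hGtop : Filter.Tendsto G Filter.atTop (nhds 1))
    (hf_pos : ∀ x, x₀ ≤ x → 0 < f x) (hg_pos : ∀ x, x₀ ≤ x → 0 < g x)
    (hf_diff : ∀ x, x₀ ≤ x → DifferentiableAt ℝ f x)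
    (hg_diff : ∀ x, x₀ ≤ x → DifferentiableAt ℝ g x)
    (hf' : Filter.Tendsto (deriv f) Filter.atTop (nhds 0))
    (hg' : Filter.Tendsto (deriv g) Filter.atTop (nhds 0))
    (hFrep : ∀ x, x₀ < x → 1 - F x = k₁ * Real.exp (-∫ u in x₀..x, 1 / f u))
    (hGrep : ∀ x, x₀ < x → 1 - G x = k₂ * Real.exp (-∫ u in x₀..x, 1 / g u))
    (hκ : Filter.Tendsto (fun x => f x / g x) Filter.atTop (nhds 0))
    (μF μG : Measure ℝ)
    (hμF : ∀ a b : ℝ, a ≤ b → μF (Set.Ioc a b) = ENNReal.ofReal (F b - F a))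
    (hμG : ∀ a b : ℝ, a ≤ b → μG (Set.Ioc a b) = ENNReal.ofReal (G b - G a)) :
    Filter.Tendsto
      (fun x => (∫ s in Set.Ioi x, (1 - F s) ∂μG) / ((1 - F x) * (1 - G x)))
      Filter.atTop (nhds 0) ∧
    Filter.Tendsto
      (fun x => (∫ s in Set.Ioi x, (1 - F s) ∂μG) / (∫ s in Set.Ioi x, (1 - G s) ∂μF))
      Filter.atTop (nhds 0) := by
  have hF1 := fun s => hFmono.ge_of_tendsto hFtop s
  have hG1 := fun s => hGmono.ge_of_tendsto hGtop s
  have key : ∀ ε : ℝ, 0 < ε → ∀ᶠ x in atTop,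
      (∫ s in Set.Ioi x, (1 - F s) ∂μG) ≤ ε * ∫ s in Set.Ioi x, (1 - G s) ∂μF := by
    intro ε hε
    obtain ⟨N, hN⟩ := eventually_atTop.1 (hκ.eventually (gt_mem_nhds hε))
    filter_upwards [eventually_gt_atTop x₀, eventually_ge_atTop N] with x hx hxN
    obtain ⟨i1, e1⟩ := aux_integral F G x₀ k₁ f hk₁ hFmono hGmono hFcont hGcont hFtop hGtop
      hf_pos hf_diff hFrep μF hμF x hx
    obtain ⟨i2, e2⟩ := aux_integral G F x₀ k₂ g hk₂ hGmono hFmono hGcont hFcont hGtop hFtop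
      hg_pos hg_diff hGrep μG hμG x hx
    rw [e1, e2, ← integral_const_mul]
    apply setIntegral_mono_on i2 (i1.const_mul ε) measurableSet_Ioi
    intro s hs
    have hs0 : x₀ ≤ s := (hx.trans hs).le
    have hfs := hf_pos s hs0
    have hgs := hg_pos s hs0
    have h := hN s (hxN.trans (le_of_lt hs))
    rw [div_lt_iff₀ hgs] at h
    have h1 : 1 / g s ≤ ε / f s := by
      rw [div_le_div_iff₀ hgs hfs]; linarith
    have h2 : 0 ≤ (1 - G s) * (1 - F s) :=
      mul_nonneg (by linarith [hG1 s]) (by linarith [hF1 s])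
    calc (1 - G s) / g s * (1 - F s) = (1 - G s) * (1 - F s) * (1 / g s) := by ring
      _ ≤ (1 - G s) * (1 - F s) * (ε / f s) := mul_le_mul_of_nonneg_left h1 h2
      _ = _ := by ring
  have nG : ∀ x, 0 ≤ ∫ s in Set.Ioi x, (1 - F s) ∂μG := fun x =>
    integral_nonneg fun s => by simpa using hF1 s
  have nF : ∀ x, 0 ≤ ∫ s in Set.Ioi x, (1 - G s) ∂μF := fun x =>
    integral_nonneg fun s => by simpa using hG1 s
  have nH : ∀ x, 0 ≤ (1 - F x) * (1 - G x) := fun x =>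
    mul_nonneg (by linarith [hF1 x]) (by linarith [hG1 x])
  have bF : ∀ x, ∫ s in Set.Ioi x, (1 - G s) ∂μF ≤ (1 - F x) * (1 - G x) := by
    intro x
    have hm := aux_mass F hFmono hFtop μF hμF x
    have hfin := hm.trans_lt ENNReal.ofReal_lt_top
    have hr : μF.real (Set.Ioi x) ≤ 1 - F x := by
      have := ENNReal.toReal_mono ENNReal.ofReal_ne_top hm
      rwa [ENNReal.toReal_ofReal (by linarith [hF1 x])] at this
    calc ∫ s in Set.Ioi x, (1 - G s) ∂μF ≤ ∫ s in Set.Ioi x, (1 - G x) ∂μF := by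
          apply setIntegral_mono_on
            (aux_integrable F G hFmono hGmono hGcont hFtop hGtop μF hμF x)
            (integrableOn_const hfin.ne) measurableSet_Ioi
          intro s hs
          have := hGmono (le_of_lt hs)
          linarith
      _ = μF.real (Set.Ioi x) * (1 - G x) := by rw [setIntegral_const, smul_eq_mul]
      _ ≤ _ := mul_le_mul_of_nonneg_right hr (by linarith [hG1 x])
  have fin : ∀ D : ℝ → ℝ, (∀ x, 0 ≤ D x) →
      (∀ x, ∫ s in Set.Ioi x, (1 - G s) ∂μF ≤ D x) →
      Tendsto (fun x => (∫ s in Set.Ioi x, (1 - F s) ∂μG) / D x) atTop (nhds 0) := by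
    intro D hD hle
    rw [Metric.tendsto_nhds]
    intro ε hε
    filter_upwards [key (ε / 2) (by positivity)] with x hx
    rw [Real.dist_eq, sub_zero, abs_of_nonneg (div_nonneg (nG x) (hD x))]
    have : (∫ s in Set.Ioi x, (1 - F s) ∂μG) / D x ≤ ε / 2 := by
      apply div_le_of_le_mul₀ (hD x) (by positivity)
      exact hx.trans (mul_le_mul_of_nonneg_left (hle x) (by positivity))
    linarith
  exact ⟨fin _ nH bF, fin _ nF fun x => le_rfl⟩
end

section
/- Suppose that lim_{x→∞} (1/H̄(x)) · ∫_{(x,∞)} Ḡ(y) μ_F(dy) = k for some k ∈ (0,1), where μ_F is the Lebesgue–Stieltjes measure of F. Then lim_{x→∞} f(x)/g(x) = (1−k)/k. -/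
open Filter Real MeasureTheory

lemma aux_rep (F : ℝ → ℝ) (x₀ k₁ : ℝ) (f : ℝ → ℝ)
    (hf_pos : ∀ x, x₀ ≤ x → 0 < f x)
    (hf_diff : ∀ x, x₀ ≤ x → DifferentiableAt ℝ f x)
    (hFrep : ∀ x, x₀ < x → 1 - F x = k₁ * Real.exp (-∫ u in x₀..x, 1 / f u))
    (x : ℝ) (hx : x₀ < x) : HasDerivAt F ((1 - F x) / f x) x := by
  have hcont : ∀ y, x₀ ≤ y → ContinuousAt (fun u => 1 / f u) y := fun y hy =>
    continuousAt_const.div (hf_diff y hy).continuousAt (hf_pos y hy).ne'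
  have h1 : HasDerivAt (fun y => ∫ u in x₀..y, 1 / f u) (1 / f x) x := by
    apply intervalIntegral.integral_hasDerivAt_right
    · apply ContinuousOn.intervalIntegrable
      intro y hy
      rw [Set.uIcc_of_le hx.le] at hy
      exact (hcont y hy.1).continuousWithinAt
    · exact ContinuousOn.stronglyMeasurableAtFilter isOpen_Ioi
        (s := Set.Ioi x₀) (fun y hy => (hcont y (le_of_lt hy)).continuousWithinAt) x hx
    · exact hcont x hx.le
  have h2 := ((h1.neg.exp).const_mul k₁).const_sub 1
  have h3 : HasDerivAt F (-(k₁ * (rexp (-∫ u in x₀..x, 1 / f u) * -(1 / f x)))) x := by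
    refine h2.congr_of_eventuallyEq ?_
    filter_upwards [lt_mem_nhds hx] with y hy
    have := hFrep y hy
    simp only [Pi.neg_apply]
    linarith
  convert h3 using 1
  rw [hFrep x hx]
  ring

lemma aux_int (F G : ℝ → ℝ) (hFmono : Monotone F) (hGmono : Monotone G)
    (hGcont : Continuous G) (μF : Measure ℝ)
    (hμF : ∀ a b : ℝ, a ≤ b → μF (Set.Ioc a b) = ENNReal.ofReal (F b - F a))
    (X : ℝ) (hint : IntegrableOn (fun y => 1 - G y) (Set.Ioi X) μF)
    (x d : ℝ) (hx : X < x) (hF : HasDerivAt F d x) :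
    HasDerivAt (fun x => ∫ y in Set.Ioi x, (1 - G y) ∂μF) (-((1 - G x) * d)) x := by
  set I : ℝ → ℝ := fun x => ∫ y in Set.Ioi x, (1 - G y) ∂μF with hI
  have hsplit : ∀ a b, X ≤ a → a ≤ b → I a - I b = ∫ y in Set.Ioc a b, (1 - G y) ∂μF := by
    intro a b ha hab
    have : Set.Ioi a = Set.Ioc a b ∪ Set.Ioi b := (Set.Ioc_union_Ioi_eq_Ioi hab).symm
    simp only [hI]
    rw [this, setIntegral_union (Set.Ioc_disjoint_Ioi le_rfl) measurableSet_Ioi]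
    · ring
    · exact hint.mono_set (fun y hy => lt_of_le_of_lt ha hy.1)
    · exact hint.mono_set (fun y hy => lt_of_le_of_lt (ha.trans hab) hy)
  have hb : ∀ a b, X ≤ a → a ≤ b → (1 - G b) * (F b - F a) ≤ I a - I b ∧
      I a - I b ≤ (1 - G a) * (F b - F a) := by
    intro a b ha hab
    rw [hsplit a b ha hab]
    have hfin : μF (Set.Ioc a b) ≠ ⊤ := by rw [hμF a b hab]; exact ENNReal.ofReal_ne_top
    have hreal : μF.real (Set.Ioc a b) = F b - F a := by
      rw [Measure.real, hμF a b hab, ENNReal.toReal_ofReal (sub_nonneg.2 (hFmono hab))]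
    have hc : ∀ c : ℝ, ∫ y in Set.Ioc a b, c ∂μF = c * (F b - F a) := by
      intro c
      rw [setIntegral_const, hreal, smul_eq_mul, mul_comm]
    have hi : IntegrableOn (fun y => 1 - G y) (Set.Ioc a b) μF :=
      hint.mono_set (fun y hy => lt_of_le_of_lt ha hy.1)
    rw [← hc, ← hc]
    constructor
    · apply setIntegral_mono_on (integrableOn_const hfin) hi measurableSet_Ioc
      intro y hy
      have := hGmono hy.2
      linarith
    · apply setIntegral_mono_on hi (integrableOn_const hfin) measurableSet_Ioc
      intro y hy
      have := hGmono hy.1.le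
      linarith
  have key : ∀ y, X < y → |I y - I x + (1 - G x) * (F y - F x)| ≤ |G y - G x| * |F y - F x| := by
    intro y hy
    rw [← abs_mul]
    rcases le_total x y with h | h
    · have := hb x y hx.le h
      have h1 := mul_nonneg (sub_nonneg.2 (hGmono h)) (sub_nonneg.2 (hFmono h))
      rw [abs_of_nonneg h1, abs_le]
      constructor <;> nlinarith
    · have := hb y x hy.le h
      have h1 := mul_nonneg (sub_nonneg.2 (hGmono h)) (sub_nonneg.2 (hFmono h))
      have h2 : 0 ≤ (G y - G x) * (F y - F x) := by nlinarith
      rw [abs_of_nonneg h2, abs_le]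
      constructor <;> nlinarith
  have hE : HasDerivAt (fun y => I y + (1 - G x) * (F y - F x)) 0 x := by
    rw [hasDerivAt_iff_isLittleO]
    have h1 : (fun y => G y - G x) =o[nhds x] (fun _ => (1 : ℝ)) := by
      rw [Asymptotics.isLittleO_one_iff]
      have := (hGcont.tendsto x).sub_const (G x)
      simpa using this
    have h2 : (fun y => F y - F x) =O[nhds x] (fun y => y - x) := hF.isBigO_sub
    have h3 := h1.mul_isBigO h2
    simp only [one_mul] at h3
    refine Asymptotics.IsBigO.trans_isLittleO ?_ h3
    apply Asymptotics.IsBigO.of_bound 1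
    filter_upwards [lt_mem_nhds hx] with y hy
    have := key y hy
    simp only [Real.norm_eq_abs, one_mul, abs_mul]
    convert this using 2
    simp
    ring
  have h4 := hE.sub ((hF.sub_const (F x)).const_mul (1 - G x))
  have e : ((fun y => I y + (1 - G x) * (F y - F x)) - fun y => (1 - G x) * (F y - F x)) = I := by
    funext y
    simp
  rw [e] at h4
  exact h4.congr_deriv (by ring)

lemma aux_core (x₀ k : ℝ) (f g R : ℝ → ℝ)
    (hf_pos : ∀ x, x₀ ≤ x → 0 < f x) (hg_pos : ∀ x, x₀ ≤ x → 0 < g x)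
    (hf_diff : ∀ x, x₀ ≤ x → DifferentiableAt ℝ f x)
    (hg_diff : ∀ x, x₀ ≤ x → DifferentiableAt ℝ g x)
    (hf' : Tendsto (deriv f) atTop (nhds 0))
    (hg' : Tendsto (deriv g) atTop (nhds 0))
    (hR : ∀ x, x₀ ≤ x →
      HasDerivAt R ((R x - g x / (f x + g x)) / (f x * g x / (f x + g x))) x)
    (hlim : Tendsto R atTop (nhds k)) :
    Tendsto (fun x => g x / (f x + g x)) atTop (nhds k) := by
  set p : ℝ → ℝ := fun x => g x / (f x + g x) with hp
  set h : ℝ → ℝ := fun x => f x * g x / (f x + g x) with hh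
  have hhpos : ∀ x, x₀ ≤ x → 0 < h x := fun x hx =>
    div_pos (mul_pos (hf_pos x hx) (hg_pos x hx)) (add_pos (hf_pos x hx) (hg_pos x hx))
  have hpd : ∀ x, x₀ ≤ x → HasDerivAt p
      ((deriv g x * f x - g x * deriv f x) / (f x + g x) ^ 2) x := by
    intro x hx
    have h1 := (hf_diff x hx).hasDerivAt
    have h2 := (hg_diff x hx).hasDerivAt
    have h3 := h2.div (h1.add h2) (add_pos (hf_pos x hx) (hg_pos x hx)).ne'
    refine h3.congr_deriv ?_
    simp only [Pi.add_apply]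
    ring
  have hhd : ∀ x, x₀ ≤ x → HasDerivAt h
      ((deriv f x * g x ^ 2 + deriv g x * f x ^ 2) / (f x + g x) ^ 2) x := by
    intro x hx
    have h1 := (hf_diff x hx).hasDerivAt
    have h2 := (hg_diff x hx).hasDerivAt
    have h3 := (h1.mul h2).div (h1.add h2) (add_pos (hf_pos x hx) (hg_pos x hx)).ne'
    refine h3.congr_deriv ?_
    simp only [Pi.add_apply, Pi.mul_apply]
    ring
  rw [Metric.tendsto_atTop]
  intro ε hε
  obtain ⟨δ, hδ, hδ1, hδ2⟩ : ∃ δ : ℝ, 0 < δ ∧ δ ≤ 1 / 4 ∧ δ ≤ ε / 16 :=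
    ⟨min (1/4) (ε/16), by positivity, min_le_left _ _, min_le_right _ _⟩
  obtain ⟨X1, h1⟩ := Metric.tendsto_atTop.1 hf' δ hδ
  obtain ⟨X2, h2⟩ := Metric.tendsto_atTop.1 hg' δ hδ
  obtain ⟨X3, h3⟩ := Metric.tendsto_atTop.1 hlim δ hδ
  simp only [Real.dist_eq, sub_zero] at h1 h2 h3
  obtain ⟨X, hX0, hX1, hX2, hX3⟩ : ∃ X, x₀ ≤ X ∧ X1 ≤ X ∧ X2 ≤ X ∧ X3 ≤ X :=
    ⟨max (max x₀ X1) (max X2 X3), by simp, by simp, by simp, by simp⟩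
  -- derivative bounds
  have bh : ∀ x, X ≤ x →
      |(deriv f x * g x ^ 2 + deriv g x * f x ^ 2) / (f x + g x) ^ 2| ≤ 1 / 2 := by
    intro x hx
    have a := hf_pos x (hX0.trans hx)
    have b := hg_pos x (hX0.trans hx)
    have c := abs_lt.1 (h1 x (hX1.trans hx))
    have d := abs_lt.1 (h2 x (hX2.trans hx))
    have hs : 0 < (f x + g x) ^ 2 := by positivity
    have hab := mul_pos a b
    rw [abs_div, abs_of_pos hs, div_le_iff₀ hs, abs_le]
    have ha2 : 0 < f x ^ 2 := by positivity
    have hb2 : 0 < g x ^ 2 := by positivity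
    have e1 : deriv f x * g x ^ 2 ≤ 1/4 * g x ^ 2 :=
      mul_le_mul_of_nonneg_right (by linarith) hb2.le
    have e2 : deriv g x * f x ^ 2 ≤ 1/4 * f x ^ 2 :=
      mul_le_mul_of_nonneg_right (by linarith) ha2.le
    have e3 : (-1/4) * g x ^ 2 ≤ deriv f x * g x ^ 2 :=
      mul_le_mul_of_nonneg_right (by linarith) hb2.le
    have e4 : (-1/4) * f x ^ 2 ≤ deriv g x * f x ^ 2 :=
      mul_le_mul_of_nonneg_right (by linarith) ha2.le
    constructor <;> nlinarith
  have bp : ∀ x, X ≤ x →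
      |(deriv g x * f x - g x * deriv f x) / (f x + g x) ^ 2| * h x ≤ 2 * δ := by
    intro x hx
    have a := hf_pos x (hX0.trans hx)
    have b := hg_pos x (hX0.trans hx)
    have c := abs_lt.1 (h1 x (hX1.trans hx))
    have d := abs_lt.1 (h2 x (hX2.trans hx))
    have hs : 0 < (f x + g x) ^ 2 := by positivity
    have hs1 : 0 < (f x + g x) := by positivity
    have t1 : |deriv g x * f x - g x * deriv f x| ≤ δ * (f x + g x) := by
      rw [abs_le]
      constructor <;> nlinarith
    have t2 : h x ≤ f x + g x := by
      simp only [hh]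
      rw [div_le_iff₀ hs1]
      nlinarith [mul_pos a b]
    rw [abs_div, abs_of_pos hs]
    calc _ ≤ δ * (f x + g x) / (f x + g x) ^ 2 * (f x + g x) := by
          have := hhpos x (hX0.trans hx)
          gcongr
      _ = δ := by field_simp
      _ ≤ 2 * δ := by linarith
  refine ⟨X, fun x hx => ?_⟩
  have hx0 := hX0.trans hx
  have hhx := hhpos x hx0
  have hcomp : ∀ η, x < η → η < x + h x → h x ≤ 2 * h η ∧ h η ≤ 3 / 2 * h x := by
    intro η hη1 hη2
    obtain ⟨z, hz, hz'⟩ := exists_hasDerivAt_eq_slope h _ hη1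
      (fun y hy => (hhd y (hx0.trans hy.1)).continuousAt.continuousWithinAt)
      (fun y hy => hhd y (hx0.trans hy.1.le))
    have hb := bh z (hx.trans hz.1.le)
    rw [hz', abs_div, abs_of_pos (sub_pos.2 hη1), div_le_iff₀ (sub_pos.2 hη1)] at hb
    have := abs_le.1 hb
    constructor <;> linarith
  obtain ⟨ξ, hξ, hξ'⟩ := exists_hasDerivAt_eq_slope R _ (show x < x + h x by linarith)
      (fun y hy => (hR y (hx0.trans hy.1)).continuousAt.continuousWithinAt)
      (fun y hy => hR y (hx0.trans hy.1.le))
  obtain ⟨η, hη, hη'⟩ := exists_hasDerivAt_eq_slope p _ hξ.1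
      (fun y hy => (hpd y (hx0.trans hy.1)).continuousAt.continuousWithinAt)
      (fun y hy => hpd y (hx0.trans hy.1.le))
  have A : |R ξ - p ξ| ≤ 3 * δ := by
    have hhξ := hhpos ξ (hx0.trans hξ.1.le)
    have e : (R ξ - p ξ) / h ξ = (R (x + h x) - R x) / h x := by
      have := hξ'
      rw [add_sub_cancel_left] at this
      exact this
    have e1 : R ξ - p ξ = (R (x + h x) - R x) * (h ξ / h x) := by
      field_simp at e ⊢
      linarith
    have e2 : h ξ / h x ≤ 3 / 2 := by
      rw [div_le_iff₀ hhx]; exact (hcomp ξ hξ.1 hξ.2).2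
    have e3 : |R (x + h x) - R x| ≤ 2 * δ := by
      have q1 := abs_lt.1 (h3 (x + h x) (by linarith))
      have q2 := abs_lt.1 (h3 x (by linarith))
      rw [abs_le]; constructor <;> linarith
    rw [e1, abs_mul, abs_of_pos (div_pos hhξ hhx)]
    calc _ ≤ 2 * δ * (3 / 2) := by
          have := div_pos hhξ hhx
          gcongr
      _ = 3 * δ := by ring
  have B : |p ξ - p x| ≤ 4 * δ := by
    have hb := bp η (hx.trans hη.1.le)
    have hc := (hcomp η hη.1 (hη.2.trans hξ.2)).1
    have hpos := sub_pos.2 hξ.1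
    rw [hη', abs_div, abs_of_pos hpos, div_mul_eq_mul_div, div_le_iff₀ hpos] at hb
    have hhη := hhpos η (hx0.trans hη.1.le)
    have h5 : ξ - x ≤ 2 * h η := by linarith [hξ.2]
    have h6 : |p ξ - p x| * h η ≤ (4 * δ) * h η := by nlinarith
    exact le_of_mul_le_mul_right h6 hhη
  have C := abs_lt.1 (h3 ξ (by linarith [hξ.1]))
  have A' := abs_le.1 A
  have B' := abs_le.1 B
  rw [Real.dist_eq, abs_lt]
  constructor <;> linarith

/-- partial converse: if `F̄` and `Ḡ` are von Mises tails with auxiliary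
functions `f`, `g`, and `(1/H̄(x)) ∫_{(x,∞)} Ḡ dμ_F → k ∈ (0,1)` as `x → ∞`, then
`f(x)/g(x) → (1-k)/k`. -/
theorem converse_balance_condition
    (F G : ℝ → ℝ) (x₀ k₁ k₂ k : ℝ) (f g : ℝ → ℝ)
    (hx₀ : 0 ≤ x₀) (hk₁ : 0 < k₁) (hk₂ : 0 < k₂)
    (hFmono : Monotone F) (hGmono : Monotone G)
    (hFcont : Continuous F) (hGcont : Continuous G)
    (hFneg : ∀ x, x < 0 → F x = 0) (hGneg : ∀ x, x < 0 → G x = 0)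
    (hFtop : Filter.Tendsto F Filter.atTop (nhds 1))
    (hGtop : Filter.Tendsto G Filter.atTop (nhds 1))
    (hf_pos : ∀ x, x₀ ≤ x → 0 < f x) (hg_pos : ∀ x, x₀ ≤ x → 0 < g x)
    (hf_diff : ∀ x, x₀ ≤ x → DifferentiableAt ℝ f x)
    (hg_diff : ∀ x, x₀ ≤ x → DifferentiableAt ℝ g x)
    (hf' : Filter.Tendsto (deriv f) Filter.atTop (nhds 0))
    (hg' : Filter.Tendsto (deriv g) Filter.atTop (nhds 0))
    (hFrep : ∀ x, x₀ < x → 1 - F x = k₁ * Real.exp (-∫ u in x₀..x, 1 / f u))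
    (hGrep : ∀ x, x₀ < x → 1 - G x = k₂ * Real.exp (-∫ u in x₀..x, 1 / g u))
    (μF : Measure ℝ)
    (hμF : ∀ a b : ℝ, a ≤ b → μF (Set.Ioc a b) = ENNReal.ofReal (F b - F a))
    (hk : k ∈ Set.Ioo (0 : ℝ) 1)
    (hlim : Filter.Tendsto
      (fun x => (∫ y in Set.Ioi x, (1 - G y) ∂μF) / ((1 - F x) * (1 - G x)))
      Filter.atTop (nhds k)) :
    Filter.Tendsto (fun x => f x / g x) Filter.atTop (nhds ((1 - k) / k)) := by
  have hF0 : ∀ x, x₀ < x → 0 < 1 - F x := fun x hx => by rw [hFrep x hx]; positivity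
  have hG0 : ∀ x, x₀ < x → 0 < 1 - G x := fun x hx => by rw [hGrep x hx]; positivity
  obtain ⟨X, hX⟩ := eventually_atTop.1
    (((tendsto_order.1 hlim).1 0 hk.1).and (eventually_gt_atTop x₀))
  have hint : IntegrableOn (fun y => 1 - G y) (Set.Ioi X) μF := by
    by_contra hcon
    have h1 := (hX X le_rfl).1
    rw [integral_undef hcon] at h1
    simp at h1
  have hX0 : x₀ < X := (hX X le_rfl).2
  have hmain : Tendsto (fun x => g x / (f x + g x)) atTop (nhds k) := by
    refine aux_core (X + 1) k f g _ (fun x hx => hf_pos x (by linarith))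
      (fun x hx => hg_pos x (by linarith)) (fun x hx => hf_diff x (by linarith))
      (fun x hx => hg_diff x (by linarith)) hf' hg' ?_ hlim
    intro x hx
    have hxX : X < x := by linarith
    have hx0 : x₀ < x := hX0.trans hxX
    have dF := aux_rep F x₀ k₁ f hf_pos hf_diff hFrep x hx0
    have dG := aux_rep G x₀ k₂ g hg_pos hg_diff hGrep x hx0
    have dI := aux_int F G hFmono hGmono hGcont μF hμF X hint x _ hxX dF
    have pF := hF0 x hx0
    have pG := hG0 x hx0
    have pf := hf_pos x hx0.le
    have pg := hg_pos x hx0.le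
    have dH := (dF.const_sub 1).mul (dG.const_sub 1)
    have dR := dI.div dH (mul_pos pF pG).ne'
    refine dR.congr_deriv ?_
    simp only [Pi.mul_apply]
    generalize (∫ y in Set.Ioi x, (1 - G y) ∂μF) = J
    generalize 1 - F x = a at *
    generalize 1 - G x = b at *
    field_simp
    ring
  have h2 : Tendsto (fun x => (1 - g x / (f x + g x)) / (g x / (f x + g x))) atTop
      (nhds ((1 - k) / k)) := (hmain.const_sub 1).div hmain hk.1.ne'
  refine h2.congr' ?_
  filter_upwards [eventually_ge_atTop x₀] with x hx
  have pf := hf_pos x hx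
  have pg := hg_pos x hx
  field_simp
  ring
end

section
/- Let f be a positive self-neglecting function on [x₀,∞), and let H be a cumulative distribution function on ℝ with H(x) < 1 for all x and with ∫_x^∞ (H̄(y)/f(y)) dy finite for x ≥ x₀, where H̄ = 1−H. Suppose that for some k ∈ (0,1), ∫_x^∞ (H̄(y)/f(y)) dy ∼ k·H̄(x) as x → ∞. Then H is in the domain of attraction of the Gumbel distribution with an auxiliary function asymptotic to k·f: there exists a positive function h on [x₀,∞) such that lim_{x→∞} h(x)/f(x) = k and, for every y ∈ ℝ, lim_{t→∞} H̄(t + y·h(t))/H̄(t) = e^{−y}. -/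
open Filter Real MeasureTheory

/-- Discrete Gronwall bounds. -/
lemma gron_upper (u : ℝ → ℝ) (l a b : ℝ) (hl : 0 ≤ l) (hab : a ≤ b)
    (h : ∀ p q, a ≤ p → p ≤ q → q ≤ b → l * (q - p) * u q ≤ u p - u q) :
    u b ≤ exp (-(l * (b - a))) * u a := by
  have key : ∀ n : ℕ, 0 < n → (1 + l * (b - a) / n) ^ n * u b ≤ u a := by
    intro n hn
    have hn' : (0 : ℝ) < n := by exact_mod_cast hn
    have hd : 0 ≤ (b - a) / n := div_nonneg (by linarith) hn'.le
    have hfac : 0 ≤ 1 + l * (b - a) / n := by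
      rw [mul_div_assoc]; positivity
    have ind : ∀ i : ℕ, i ≤ n → (1 + l * (b - a) / n) ^ i * u (a + i * ((b - a) / n)) ≤ u a := by
      intro i
      induction i with
      | zero => intro _; simp
      | succ i ih =>
        intro hi
        have h1 := ih (by omega)
        have hi' : ((i : ℝ) + 1) ≤ n := by exact_mod_cast hi
        have hb : a + ((i : ℝ) + 1) * ((b - a) / n) ≤ b := by
          have : ((i : ℝ) + 1) * ((b - a) / n) ≤ n * ((b - a) / n) :=
            mul_le_mul_of_nonneg_right hi' hd
          rw [mul_div_cancel₀ _ hn'.ne'] at this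
          linarith
        have h2 := h (a + i * ((b - a) / n)) (a + ((i : ℝ) + 1) * ((b - a) / n))
          (by have : 0 ≤ (i : ℝ) * ((b - a) / n) := by positivity
              linarith) (by linarith) hb
        push_cast
        calc _ = (1 + l * (b - a) / n) ^ i *
              ((1 + l * (b - a) / n) * u (a + ((i : ℝ) + 1) * ((b - a) / n))) := by ring
          _ ≤ (1 + l * (b - a) / n) ^ i * u (a + i * ((b - a) / n)) := by
              apply mul_le_mul_of_nonneg_left _ (pow_nonneg hfac i)
              have e : l * (a + ((i : ℝ) + 1) * ((b - a) / n) - (a + i * ((b - a) / n)))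
                = l * (b - a) / n := by ring
              rw [e] at h2
              linarith
          _ ≤ u a := h1
    have h3 := ind n le_rfl
    rw [mul_div_cancel₀ _ hn'.ne'] at h3
    simpa using h3
  have lim : Tendsto (fun n : ℕ => (1 + l * (b - a) / n) ^ n * u b) atTop
      (nhds (exp (l * (b - a)) * u b)) :=
    (Real.tendsto_one_add_div_pow_exp (l * (b - a))).mul_const _
  have := le_of_tendsto lim (by filter_upwards [eventually_gt_atTop 0] with n hn using key n hn)
  rw [exp_neg, inv_mul_eq_div, le_div_iff₀ (exp_pos _)]
  linarith

lemma gron_lower (u : ℝ → ℝ) (l a b : ℝ) (hl : 0 ≤ l) (hab : a ≤ b)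
    (h : ∀ p q, a ≤ p → p ≤ q → q ≤ b → u p - u q ≤ l * (q - p) * u p) :
    exp (-(l * (b - a))) * u a ≤ u b := by
  have key : ∀ n : ℕ, 0 < n → l * (b - a) ≤ n → (1 + (-(l * (b - a))) / n) ^ n * u a ≤ u b := by
    intro n hn hln
    have hn' : (0 : ℝ) < n := by exact_mod_cast hn
    have hd : 0 ≤ (b - a) / n := div_nonneg (by linarith) hn'.le
    have hfac : 0 ≤ 1 + (-(l * (b - a))) / n := by
      rw [neg_div]
      have : l * (b - a) / n ≤ 1 := by rw [div_le_one hn']; exact hln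
      linarith
    have ind : ∀ i : ℕ, i ≤ n →
        (1 + (-(l * (b - a))) / n) ^ i * u a ≤ u (a + i * ((b - a) / n)) := by
      intro i
      induction i with
      | zero => intro _; simp
      | succ i ih =>
        intro hi
        have h1 := ih (by omega)
        have hi' : ((i : ℝ) + 1) ≤ n := by exact_mod_cast hi
        have hb : a + ((i : ℝ) + 1) * ((b - a) / n) ≤ b := by
          have : ((i : ℝ) + 1) * ((b - a) / n) ≤ n * ((b - a) / n) :=
            mul_le_mul_of_nonneg_right hi' hd
          rw [mul_div_cancel₀ _ hn'.ne'] at this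
          linarith
        have h2 := h (a + i * ((b - a) / n)) (a + ((i : ℝ) + 1) * ((b - a) / n))
          (by have : 0 ≤ (i : ℝ) * ((b - a) / n) := by positivity
              linarith) (by linarith) hb
        push_cast
        calc _ = (1 + (-(l * (b - a))) / n) *
              ((1 + (-(l * (b - a))) / n) ^ i * u a) := by ring
          _ ≤ (1 + (-(l * (b - a))) / n) * u (a + i * ((b - a) / n)) :=
              mul_le_mul_of_nonneg_left h1 hfac
          _ ≤ _ := by
              have e : l * (a + ((i : ℝ) + 1) * ((b - a) / n) - (a + i * ((b - a) / n)))
                = l * (b - a) / n := by ring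
              rw [e] at h2
              rw [neg_div]
              linarith
    have h3 := ind n le_rfl
    rw [mul_div_cancel₀ _ hn'.ne'] at h3
    simpa using h3
  have lim : Tendsto (fun n : ℕ => (1 + (-(l * (b - a))) / n) ^ n * u a) atTop
      (nhds (exp (-(l * (b - a))) * u a)) :=
    (Real.tendsto_one_add_div_pow_exp _).mul_const _
  refine le_of_tendsto lim ?_
  filter_upwards [eventually_gt_atTop 0,
    (tendsto_natCast_atTop_atTop (R := ℝ)).eventually_ge_atTop (l * (b - a))] with n hn hn2
  exact key n hn hn2

/-- Self-neglecting functions are `o(x)`, in the form needed. -/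
lemma sn_far (x₀ : ℝ) (f : ℝ → ℝ)
    (hf_pos : ∀ x, x₀ ≤ x → 0 < f x)
    (hf_sn : ∀ K : Set ℝ, IsCompact K →
      TendstoUniformlyOn (fun x y => f (x + y * f x) / f x) (fun _ => 1) Filter.atTop K)
    (M T : ℝ) (hM : 0 ≤ M) : ∀ᶠ x in atTop, T ≤ x - M * f x := by
  have h1 := Metric.tendstoUniformlyOn_iff.1 (hf_sn _ (isCompact_Icc (a := -M) (b := 0)))
    (1 / 2) (by norm_num)
  filter_upwards [h1, eventually_ge_atTop x₀, eventually_ge_atTop T,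
    eventually_ge_atTop (T + M * (2 * f T))] with x h hx0 hxT hx
  by_contra! hc
  have hfx := hf_pos x hx0
  have h2 := h ((T - x) / f x) ⟨by rw [le_div_iff₀ hfx]; linarith,
    div_nonpos_of_nonpos_of_nonneg (by linarith) hfx.le⟩
  rw [div_mul_cancel₀ _ hfx.ne', add_sub_cancel, Real.dist_eq, abs_lt] at h2
  have h3 : 1 / 2 < f T / f x := by linarith [h2.2]
  rw [lt_div_iff₀ hfx] at h3
  have : M * f x ≤ M * (2 * f T) := mul_le_mul_of_nonneg_left (by linarith) hM
  linarith

/-- if `f` is positive and self-neglecting on `[x₀,∞)` (the convergence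
`f(x+y f(x))/f(x) → 1` holding locally uniformly in `y`), `H` is a cdf with `H(x) < 1`
everywhere, the integrals `∫_x^∞ H̄(y)/f(y) dy` are finite, and
`∫_x^∞ H̄(y)/f(y) dy ∼ k H̄(x)` for some `k ∈ (0,1)`, then `H` is in the domain of
attraction of the Gumbel distribution with an auxiliary function `h ∼ k f`. -/
theorem self_neglecting_lemma
    (x₀ k : ℝ) (f : ℝ → ℝ) (H : ℝ → ℝ)
    (hf_pos : ∀ x, x₀ ≤ x → 0 < f x)
    (hf_sn : ∀ K : Set ℝ, IsCompact K →
      TendstoUniformlyOn (fun x y => f (x + y * f x) / f x) (fun _ => 1) Filter.atTop K)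
    (hHmono : Monotone H)
    (hHtop : Filter.Tendsto H Filter.atTop (nhds 1))
    (hHbot : Filter.Tendsto H Filter.atBot (nhds 0))
    (hHlt : ∀ x, H x < 1)
    (hint : ∀ x, x₀ ≤ x → IntegrableOn (fun y => (1 - H y) / f y) (Set.Ioi x) volume)
    (hk : k ∈ Set.Ioo (0 : ℝ) 1)
    (hasymp : Filter.Tendsto
      (fun x => (∫ y in Set.Ioi x, (1 - H y) / f y) / (1 - H x))
      Filter.atTop (nhds k)) :
    ∃ h : ℝ → ℝ, (∀ x, x₀ ≤ x → 0 < h x) ∧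
      Filter.Tendsto (fun x => h x / f x) Filter.atTop (nhds k) ∧
      (∀ y : ℝ, Filter.Tendsto (fun t => (1 - H (t + y * h t)) / (1 - H t))
        Filter.atTop (nhds (Real.exp (-y)))) := by
  obtain ⟨hk0, hk1⟩ := hk
  set I : ℝ → ℝ := fun x => ∫ y in Set.Ioi x, (1 - H y) / f y with hI
  have hasymp' : Tendsto (fun x => I x / (1 - H x)) atTop (nhds k) := hasymp
  have hHb : ∀ x, 0 < 1 - H x := fun x => by linarith [hHlt x]
  have hdiff : ∀ p q, x₀ ≤ p → p ≤ q → I p - I q = ∫ y in Set.Ioc p q, (1 - H y) / f y := by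
    intro p q hp hpq
    have e : Set.Ioi p = Set.Ioc p q ∪ Set.Ioi q := (Set.Ioc_union_Ioi_eq_Ioi hpq).symm
    have : I p = (∫ y in Set.Ioc p q, (1 - H y) / f y) + I q := by
      simp only [hI]
      rw [e, setIntegral_union (Set.Ioc_disjoint_Ioi le_rfl) measurableSet_Ioi
        ((hint p hp).mono_set Set.Ioc_subset_Ioi_self) (hint q (hp.trans hpq))]
    linarith
  have hanti : ∀ p q, x₀ ≤ p → p ≤ q → I q ≤ I p := by
    intro p q hp hpq
    have h1 : 0 ≤ ∫ y in Set.Ioc p q, (1 - H y) / f y :=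
      setIntegral_nonneg measurableSet_Ioc
        (fun y hy => (div_pos (hHb y) (hf_pos y (hp.trans hy.1.le))).le)
    linarith [hdiff p q hp hpq]
  have hlow : ∀ p q m, x₀ ≤ p → p ≤ q → (∀ y ∈ Set.Ioc p q, m ≤ (1 - H y) / f y) →
      m * (q - p) ≤ I p - I q := by
    intro p q m hp hpq hm
    rw [hdiff p q hp hpq]
    have := setIntegral_mono_on (μ := volume) (s := Set.Ioc p q) (f := fun _ => m)
      (by simp) ((hint p hp).mono_set Set.Ioc_subset_Ioi_self) measurableSet_Ioc hm
    simpa [hpq, mul_comm] using this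
  have hupp : ∀ p q m, x₀ ≤ p → p ≤ q → (∀ y ∈ Set.Ioc p q, (1 - H y) / f y ≤ m) →
      I p - I q ≤ m * (q - p) := by
    intro p q m hp hpq hm
    rw [hdiff p q hp hpq]
    have := setIntegral_mono_on (μ := volume) (s := Set.Ioc p q) (g := fun _ => m)
      ((hint p hp).mono_set Set.Ioc_subset_Ioi_self) (by simp) measurableSet_Ioc hm
    simpa [hpq, mul_comm] using this
  -- the basic estimate
  have main : ∀ c η : ℝ, 0 < η → η < k → ∀ᶠ t in atTop, I (t + c * f t) / I t ∈
      Set.uIcc (exp (-(1 / ((k + η) * (1 + η)) * c))) (exp (-(1 / ((k - η) * (1 - η)) * c))) := by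
    intro c η hη hηk
    have hkη : 0 < k - η := by linarith
    have h1η : 0 < 1 - η := by linarith
    obtain ⟨T, hT⟩ := eventually_atTop.1
      ((Metric.tendsto_nhds.1 hasymp' η hη).and (eventually_ge_atTop x₀))
    filter_upwards [sn_far x₀ f hf_pos hf_sn |c| T (abs_nonneg c),
      Metric.tendstoUniformlyOn_iff.1 (hf_sn _ (isCompact_Icc (a := -|c|) (b := |c|))) η hη,
      eventually_ge_atTop T] with t ht1 ht2 htT
    have hft : 0 < f t := hf_pos t (hT t htT).2
    set l := 1 / ((k + η) * (1 + η)) with hl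
    set m := 1 / ((k - η) * (1 - η)) with hm
    have hl0 : 0 < l := by positivity
    have hm0 : 0 < m := by positivity
    have hIb : ∀ x, T ≤ x → (k - η) * (1 - H x) ≤ I x ∧ I x ≤ (k + η) * (1 - H x) := by
      intro x hx
      have := (hT x hx).1
      rw [Real.dist_eq, abs_lt] at this
      rw [← le_div_iff₀ (hHb x), ← div_le_iff₀ (hHb x)]
      constructor <;> linarith [this.1, this.2]
    have hIpos : ∀ x, T ≤ x → 0 < I x := fun x hx =>
      lt_of_lt_of_le (mul_pos hkη (hHb x)) (hIb x hx).1
    have hxT : ∀ s, -|c| ≤ s → T ≤ t + s * f t := by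
      intro s hs
      have := mul_le_mul_of_nonneg_right hs hft.le
      linarith
    have hfb : ∀ s, -|c| ≤ s → s ≤ |c| → (1 - η) * f t ≤ f (t + s * f t) ∧
        f (t + s * f t) ≤ (1 + η) * f t := by
      intro s hs hs'
      have := ht2 s ⟨hs, hs'⟩
      rw [Real.dist_eq, abs_lt] at this
      rw [← le_div_iff₀ hft, ← div_le_iff₀ hft]
      constructor <;> linarith [this.1, this.2]
    have hgb : ∀ s, -|c| ≤ s → s ≤ |c| →
        l * I (t + s * f t) / f t ≤ (1 - H (t + s * f t)) / f (t + s * f t) ∧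
        (1 - H (t + s * f t)) / f (t + s * f t) ≤ m * I (t + s * f t) / f t := by
      intro s hs hs'
      obtain ⟨f1, f2⟩ := hfb s hs hs'
      obtain ⟨i1, i2⟩ := hIb _ (hxT s hs)
      have hp := hHb (t + s * f t)
      have hIp := hIpos _ (hxT s hs)
      have hfp : 0 < f (t + s * f t) := hf_pos _ (hT _ (hxT s hs)).2
      generalize t + s * f t = z at *
      constructor
      · rw [div_le_div_iff₀ hft hfp, hl, one_div, inv_mul_eq_div, div_mul_eq_mul_div,
          div_le_iff₀ (by positivity)]
        calc I z * f z ≤ ((k + η) * (1 - H z)) * ((1 + η) * f t) := by gcongr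
          _ = _ := by ring
      · rw [div_le_div_iff₀ hfp hft, hm, one_div, inv_mul_eq_div, div_mul_eq_mul_div,
          le_div_iff₀ (by positivity)]
        calc _ = ((k - η) * (1 - H z)) * ((1 - η) * f t) := by ring
          _ ≤ I z * f z := by gcongr
    -- points of the interval are of the form `t + s f t`
    have hpt : ∀ p q, ∀ y ∈ Set.Ioc (t + p * f t) (t + q * f t),
        ∃ s, p ≤ s ∧ s ≤ q ∧ y = t + s * f t := by
      intro p q y hy
      refine ⟨(y - t) / f t, ?_, ?_, ?_⟩
      · rw [le_div_iff₀ hft]; linarith [hy.1]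
      · rw [div_le_iff₀ hft]; linarith [hy.2]
      · rw [div_mul_cancel₀ _ hft.ne']; ring
    have hmono : ∀ p q, p ≤ q → t + p * f t ≤ t + q * f t := by
      intro p q hpq
      have := mul_le_mul_of_nonneg_right hpq hft.le
      linarith
    have hL : ∀ p q, -|c| ≤ p → p ≤ q → q ≤ |c| →
        l * (q - p) * I (t + q * f t) ≤ I (t + p * f t) - I (t + q * f t) := by
      intro p q hp hpq hq
      have := hlow (t + p * f t) (t + q * f t) (l * I (t + q * f t) / f t)
        (hT _ (hxT p hp)).2 (hmono p q hpq) (by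
          intro y hy
          obtain ⟨s, hs1, hs2, rfl⟩ := hpt p q y hy
          refine le_trans ?_ (hgb s (hp.trans hs1) (hs2.trans hq)).1
          have := hanti _ _ (hT _ (hxT s (hp.trans hs1))).2 (hmono s q hs2)
          gcongr)
      convert this using 1
      field_simp
      ring
    have hU : ∀ p q, -|c| ≤ p → p ≤ q → q ≤ |c| →
        I (t + p * f t) - I (t + q * f t) ≤ m * (q - p) * I (t + p * f t) := by
      intro p q hp hpq hq
      have := hupp (t + p * f t) (t + q * f t) (m * I (t + p * f t) / f t)
        (hT _ (hxT p hp)).2 (hmono p q hpq) (by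
          intro y hy
          obtain ⟨s, hs1, hs2, rfl⟩ := hpt p q y hy
          refine le_trans (hgb s (hp.trans hs1) (hs2.trans hq)).2 ?_
          have := hanti _ _ (hT _ (hxT p hp)).2 (hmono p s hs1)
          gcongr)
      convert this using 1
      field_simp
      ring
    have hIt := hIpos t htT
    rcases le_total 0 c with hc | hc
    · have habs : |c| = c := abs_of_nonneg hc
      have a1 := gron_upper (fun s => I (t + s * f t)) l 0 c hl0.le hc
        (fun p q hp hpq hq => hL p q (by linarith [abs_nonneg c]) hpq (by linarith))
      have a2 := gron_lower (fun s => I (t + s * f t)) m 0 c hm0.le hc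
        (fun p q hp hpq hq => hU p q (by linarith [abs_nonneg c]) hpq (by linarith))
      simp only [zero_mul, add_zero, sub_zero] at a1 a2
      apply Set.Icc_subset_uIcc'
      exact ⟨by rwa [le_div_iff₀ hIt], by rwa [div_le_iff₀ hIt]⟩
    · have habs : |c| = -c := abs_of_nonpos hc
      have a1 := gron_upper (fun s => I (t + s * f t)) l c 0 hl0.le hc
        (fun p q hp hpq hq => hL p q (by linarith) hpq (by linarith))
      have a2 := gron_lower (fun s => I (t + s * f t)) m c 0 hm0.le hc
        (fun p q hp hpq hq => hU p q (by linarith) hpq (by linarith))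
      simp only [zero_mul, add_zero, zero_sub, mul_neg, neg_neg] at a1 a2
      apply Set.Icc_subset_uIcc
      constructor
      · rw [le_div_iff₀ hIt, exp_neg, inv_mul_eq_div, div_le_iff₀ (exp_pos _)]
        linarith
      · rw [div_le_iff₀ hIt, exp_neg, inv_mul_eq_div, le_div_iff₀ (exp_pos _)]
        linarith
  have hlim : ∀ c : ℝ, Tendsto (fun t => I (t + c * f t) / I t) atTop
      (nhds (exp (-(1 / k * c)))) := by
    intro c
    rw [Metric.tendsto_nhds]
    intro ε hε
    have c1 : Tendsto (fun η : ℝ => exp (-(1 / ((k + η) * (1 + η)) * c)))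
        (nhdsWithin 0 (Set.Ioi 0)) (nhds (exp (-(1 / k * c)))) := by
      have : ContinuousAt (fun η : ℝ => exp (-(1 / ((k + η) * (1 + η)) * c))) 0 := by
        have : (k + 0) * (1 + 0) ≠ 0 := by simpa using hk0.ne'
        fun_prop (disch := assumption)
      have h := this.tendsto
      simp only [add_zero, mul_one] at h
      exact h.mono_left nhdsWithin_le_nhds
    have c2 : Tendsto (fun η : ℝ => exp (-(1 / ((k - η) * (1 - η)) * c)))
        (nhdsWithin 0 (Set.Ioi 0)) (nhds (exp (-(1 / k * c)))) := by
      have : ContinuousAt (fun η : ℝ => exp (-(1 / ((k - η) * (1 - η)) * c))) 0 := by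
        have : (k - 0) * (1 - 0) ≠ 0 := by simpa using hk0.ne'
        fun_prop (disch := assumption)
      have h := this.tendsto
      simp only [sub_zero, mul_one] at h
      exact h.mono_left nhdsWithin_le_nhds
    obtain ⟨η, e1, e2, e3⟩ := ((c1.eventually (Metric.ball_mem_nhds _ hε)).and
      ((c2.eventually (Metric.ball_mem_nhds _ hε)).and
        (Ioo_mem_nhdsGT hk0))).exists
    filter_upwards [main c η e3.1 e3.2] with t ht
    have hoc : Set.OrdConnected (Metric.ball (exp (-(1 / k * c))) ε) := by
      rw [Real.ball_eq_Ioo]; exact Set.ordConnected_Ioo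
    exact hoc.uIcc_subset e1 e2 ht
  refine ⟨fun x => k * f x, fun x hx => mul_pos hk0 (hf_pos x hx), ?_, ?_⟩
  · refine Tendsto.congr' ?_ tendsto_const_nhds
    filter_upwards [eventually_ge_atTop x₀] with x hx
    rw [mul_div_cancel_right₀ _ (hf_pos x hx).ne']
  · intro y
    have hx : Tendsto (fun t => t + (y * k) * f t) atTop atTop := by
      rw [tendsto_atTop]
      intro T
      filter_upwards [sn_far x₀ f hf_pos hf_sn |y * k| T (abs_nonneg _),
        eventually_ge_atTop x₀] with t ht ht0
      have := mul_le_mul_of_nonneg_right (neg_abs_le (y * k)) (hf_pos t ht0).le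
      linarith
    have h1 := (hasymp'.comp hx).inv₀ hk0.ne'
    have h2 := (h1.mul (hlim (y * k))).mul hasymp'
    have e : k⁻¹ * exp (-(1 / k * (y * k))) * k = exp (-y) := by
      have : 1 / k * (y * k) = y := by field_simp
      rw [this]; field_simp
    rw [e] at h2
    refine h2.congr' ?_
    have hpos : ∀ᶠ x in atTop, 0 < I x := by
      filter_upwards [hasymp'.eventually (lt_mem_nhds hk0)] with x hx
      exact (div_pos_iff_of_pos_right (hHb x)).1 hx
    filter_upwards [hpos, hx.eventually hpos] with t i1 i2
    have b1 := hHb t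
    have b2 := hHb (t + y * k * f t)
    simp only [Function.comp]
    rw [← mul_assoc y k (f t)]
    field_simp
end

section
/- Under Condition A: if κ > 1 then lim_{t→∞} F̄(t)/Ḡ(t) = ∞, while if 0 ≤ κ < 1 then lim_{t→∞} F̄(t)/Ḡ(t) = 0. -/
open Filter Real

theorem tail_ratio_aux
    (F G : ℝ → ℝ) (x₀ k₁ k₂ κ : ℝ) (f g : ℝ → ℝ)
    (hk₁ : 0 < k₁) (hk₂ : 0 < k₂)
    (hFtop : Filter.Tendsto F Filter.atTop (nhds 1))
    (hf_pos : ∀ x, x₀ ≤ x → 0 < f x) (hg_pos : ∀ x, x₀ ≤ x → 0 < g x)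
    (hf_diff : ∀ x, x₀ ≤ x → DifferentiableAt ℝ f x)
    (hg_diff : ∀ x, x₀ ≤ x → DifferentiableAt ℝ g x)
    (hFrep : ∀ x, x₀ < x → 1 - F x = k₁ * Real.exp (-∫ u in x₀..x, 1 / f u))
    (hGrep : ∀ x, x₀ < x → 1 - G x = k₂ * Real.exp (-∫ u in x₀..x, 1 / g u))
    (hκ : Filter.Tendsto (fun x => f x / g x) Filter.atTop (nhds κ)) (hκ0 : 0 ≤ κ)
    (h1 : κ < 1) :
    Filter.Tendsto (fun t => (1 - F t) / (1 - G t)) Filter.atTop (nhds 0) := by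
  have hint : ∀ φ : ℝ → ℝ, (∀ x, x₀ ≤ x → 0 < φ x) →
      (∀ x, x₀ ≤ x → DifferentiableAt ℝ φ x) → ∀ a b, x₀ ≤ a → a ≤ b →
      IntervalIntegrable (fun u => 1 / φ u) MeasureTheory.volume a b := by
    intro φ hp hd a b ha hab
    apply ContinuousOn.intervalIntegrable
    rw [Set.uIcc_of_le hab]
    intro u hu
    have hu0 : x₀ ≤ u := ha.trans hu.1
    exact (continuousAt_const.div (hd u hu0).continuousAt (hp u hu0).ne').continuousWithinAt
  -- the exponent of the first tail diverges
  have hA : Tendsto (fun x => ∫ u in x₀..x, 1 / f u) atTop atTop := by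
    have h0 : Tendsto (fun x => (1 - F x) / k₁) atTop (nhds 0) := by
      have := (hFtop.const_sub 1).div_const k₁
      simpa using this
    have h2 : Tendsto (fun x => Real.exp (-∫ u in x₀..x, 1 / f u)) atTop (nhds 0) := by
      refine h0.congr' ?_
      filter_upwards [eventually_gt_atTop x₀] with x hx
      rw [hFrep x hx]
      field_simp
    have h3 := Real.tendsto_exp_comp_nhds_zero.1 h2
    exact tendsto_neg_atBot_iff.1 h3
  obtain ⟨c, hc1, hc2⟩ := exists_between h1
  have hc0 : 0 < c := hκ0.trans_lt hc1
  obtain ⟨x₁, hx₁⟩ := eventually_atTop.1 (hκ.eventually_lt_const hc1)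
  set y := max x₀ x₁ with hy
  have hy0 : x₀ ≤ y := le_max_left _ _
  have key : ∀ x, y ≤ x → (∫ u in y..x, 1 / g u) ≤ c * ∫ u in y..x, 1 / f u := by
    intro x hx
    rw [← intervalIntegral.integral_const_mul]
    apply intervalIntegral.integral_mono_on hx (hint g hg_pos hg_diff y x hy0 hx)
      ((hint f hf_pos hf_diff y x hy0 hx).const_mul c)
    intro u hu
    have hu0 : x₀ ≤ u := hy0.trans hu.1
    have hf := hf_pos u hu0
    have hg := hg_pos u hu0
    have h := hx₁ u ((le_max_right _ _).trans hu.1)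
    rw [div_lt_iff₀ hg] at h
    rw [mul_one_div, div_le_div_iff₀ hg hf]
    linarith
  have hBA : Tendsto (fun x => (∫ u in x₀..x, 1 / g u) - ∫ u in x₀..x, 1 / f u) atTop atBot := by
    have hlin : Tendsto (fun x => -(1 - c) * (∫ u in x₀..x, 1 / f u) +
        ((∫ u in x₀..y, 1 / g u) - c * ∫ u in x₀..y, 1 / f u)) atTop atBot :=
      tendsto_atBot_add_const_right _ _ (hA.const_mul_atTop_of_neg (by linarith))
    refine tendsto_atBot_mono' _ ?_ hlin
    filter_upwards [eventually_ge_atTop y] with x hx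
    have e1 := intervalIntegral.integral_add_adjacent_intervals
      (hint g hg_pos hg_diff x₀ y le_rfl hy0) (hint g hg_pos hg_diff y x hy0 hx)
    have e2 := intervalIntegral.integral_add_adjacent_intervals
      (hint f hf_pos hf_diff x₀ y le_rfl hy0) (hint f hf_pos hf_diff y x hy0 hx)
    have k := key x hx
    rw [← e1, ← e2]
    linarith
  have hfin := (Real.tendsto_exp_atBot.comp hBA).const_mul (k₁ / k₂)
  rw [mul_zero] at hfin
  refine hfin.congr' ?_
  filter_upwards [eventually_gt_atTop x₀] with x hx
  rw [hFrep x hx, hGrep x hx, mul_div_mul_comm, ← Real.exp_sub]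
  simp only [Function.comp]
  congr 2
  ring

/-- under the von Mises representations and Condition A (`f/g → κ`),
if `κ > 1` then `F̄(t)/Ḡ(t) → ∞`, while if `0 ≤ κ < 1` then `F̄(t)/Ḡ(t) → 0`. -/
theorem tail_ratio_dichotomy
    (F G : ℝ → ℝ) (x₀ k₁ k₂ κ : ℝ) (f g : ℝ → ℝ)
    (hx₀ : 0 ≤ x₀) (hk₁ : 0 < k₁) (hk₂ : 0 < k₂)
    (hFmono : Monotone F) (hGmono : Monotone G)
    (hFcont : Continuous F) (hGcont : Continuous G)
    (hFneg : ∀ x, x < 0 → F x = 0) (hGneg : ∀ x, x < 0 → G x = 0)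
    (hFtop : Filter.Tendsto F Filter.atTop (nhds 1))
    (hGtop : Filter.Tendsto G Filter.atTop (nhds 1))
    (hf_pos : ∀ x, x₀ ≤ x → 0 < f x) (hg_pos : ∀ x, x₀ ≤ x → 0 < g x)
    (hf_diff : ∀ x, x₀ ≤ x → DifferentiableAt ℝ f x)
    (hg_diff : ∀ x, x₀ ≤ x → DifferentiableAt ℝ g x)
    (hf' : Filter.Tendsto (deriv f) Filter.atTop (nhds 0))
    (hg' : Filter.Tendsto (deriv g) Filter.atTop (nhds 0))
    (hFrep : ∀ x, x₀ < x → 1 - F x = k₁ * Real.exp (-∫ u in x₀..x, 1 / f u))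
    (hGrep : ∀ x, x₀ < x → 1 - G x = k₂ * Real.exp (-∫ u in x₀..x, 1 / g u))
    (hκ : Filter.Tendsto (fun x => f x / g x) Filter.atTop (nhds κ)) (hκ0 : 0 ≤ κ) :
    (1 < κ → Filter.Tendsto (fun t => (1 - F t) / (1 - G t)) Filter.atTop Filter.atTop) ∧
    (κ < 1 → Filter.Tendsto (fun t => (1 - F t) / (1 - G t)) Filter.atTop (nhds 0)) := by
  refine ⟨fun h1 => ?_, fun h1 => tail_ratio_aux F G x₀ k₁ k₂ κ f g hk₁ hk₂ hFtop hf_pos hg_pos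
    hf_diff hg_diff hFrep hGrep hκ hκ0 h1⟩
  have hκ' : Tendsto (fun x => g x / f x) atTop (nhds κ⁻¹) := by
    simpa only [inv_div] using hκ.inv₀ (by linarith)
  have h := tail_ratio_aux G F x₀ k₂ k₁ κ⁻¹ g f hk₂ hk₁ hGtop hg_pos hf_pos
    hg_diff hf_diff hGrep hFrep hκ' (inv_nonneg.2 hκ0) (inv_lt_one_of_one_lt₀ h1)
  have hpos : ∀ᶠ t in atTop, (1 - G t) / (1 - F t) ∈ Set.Ioi (0 : ℝ) := by
    filter_upwards [eventually_gt_atTop x₀] with x hx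
    rw [hFrep x hx, hGrep x hx, Set.mem_Ioi]
    positivity
  have h2 := (tendsto_nhdsWithin_iff.2 ⟨h, hpos⟩).inv_tendsto_nhdsGT_zero
  refine h2.congr fun t => ?_
  simp only [Pi.inv_apply, inv_div]
end

section
/- Let κ > 0 and let Y₁, Y₂ be independent real random variables with cumulative distribution functions Λ(x)^{1/(1+κ)} and Λ(x)^{κ/(1+κ)} respectively, where Λ(x) = exp(−e^{−x}). Then for every x ≥ 0, P[max(Y₁, Y₂) − Y₁ > x] = κ/(e^x + κ); in particular the random variable L := max(Y₁,Y₂) − Y₁ has cdf P[L ≤ x] = 1/(1 + κ·e^{−x}) for x ≥ 0, with an atom at 0 of mass 1/(1+κ). -/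
open Filter Real MeasureTheory ProbabilityTheory

lemma exp_moment_aux {Ω : Type*} [MeasurableSpace Ω] (μ : Measure Ω) [IsProbabilityMeasure μ]
    (Y : Ω → ℝ) (hY : Measurable Y) (a c : ℝ) (ha : 0 < a) (hc : 0 < c)
    (hd : ∀ x : ℝ, (μ {ω | Y ω ≤ x}).toReal = Real.exp (-Real.exp (-x)) ^ a) :
    ∫ ω, Real.exp (-(c * Real.exp (-Y ω))) ∂μ = a / (a + c) := by
  have hint : Integrable (fun ω => Real.exp (-(c * Real.exp (-Y ω)))) μ := by
    refine Integrable.of_bound (C := 1) (by fun_prop) (Eventually.of_forall fun ω => ?_)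
    rw [Real.norm_eq_abs, abs_of_pos (Real.exp_pos _)]
    exact Real.exp_le_one_iff.2 (by have := Real.exp_pos (-Y ω); nlinarith)
  rw [hint.integral_eq_integral_meas_lt (Eventually.of_forall fun ω => (Real.exp_pos _).le)]
  have h1 : ∀ t ∈ Set.Ioi (0:ℝ), μ.real {ω | t < Real.exp (-(c * Real.exp (-Y ω)))}
      = (Set.Ioo (0:ℝ) 1).indicator (fun t => 1 - t ^ (a / c)) t := by
    intro t ht
    have ht0 : 0 < t := ht
    by_cases h : t < 1
    · rw [Set.indicator_of_mem (show t ∈ Set.Ioo (0:ℝ) 1 from ⟨ht0, h⟩)]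
      have hl : Real.log t < 0 := Real.log_neg ht0 h
      have hq : 0 < -Real.log t / c := div_pos (by linarith) hc
      have hs : {ω | t < Real.exp (-(c * Real.exp (-Y ω)))}
          = {ω | Y ω ≤ -Real.log (-Real.log t / c)}ᶜ := by
        ext ω
        simp only [Set.mem_ofPred_eq, Set.mem_compl_iff, not_le]
        rw [← Real.log_lt_iff_lt_exp ht0, neg_lt, Real.lt_log_iff_exp_lt hq, lt_div_iff₀ hc]
        constructor <;> intro h <;> linarith
      rw [hs, probReal_compl_eq_one_sub (measurableSet_le hY measurable_const), Measure.real, hd,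
        neg_neg, Real.exp_log hq, ← Real.exp_mul, Real.rpow_def_of_pos ht0]
      congr 2
      field_simp
    · rw [Set.indicator_of_notMem (fun h' => h h'.2)]
      have : {ω | t < Real.exp (-(c * Real.exp (-Y ω)))} = ∅ := by
        ext ω
        simp only [Set.mem_ofPred_eq, Set.mem_empty_iff_false, iff_false, not_lt]
        exact (Real.exp_le_one_iff.2 (by have := Real.exp_pos (-Y ω); nlinarith)).trans (not_lt.1 h)
      rw [this]; simp
  rw [setIntegral_congr_fun measurableSet_Ioi h1, setIntegral_indicator measurableSet_Ioo,
    Set.inter_eq_right.2 (fun t ht => ht.1), ← integral_Ioc_eq_integral_Ioo,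
    ← intervalIntegral.integral_of_le zero_le_one]
  have hr : 0 < a / c := div_pos ha hc
  rw [intervalIntegral.integral_sub (by simp)
    (intervalIntegral.intervalIntegrable_rpow' (by linarith)), integral_rpow (Or.inl (by linarith))]
  rw [Real.one_rpow, Real.zero_rpow (by positivity)]
  simp
  field_simp
  ring

/-- if `Y₁, Y₂` are independent with cdfs `Λ^{1/(1+κ)}` and `Λ^{κ/(1+κ)}`,
where `Λ(x) = exp(-e^{-x})` and `κ > 0`, then `L := max(Y₁,Y₂) - Y₁` satisfies
`P[L > x] = κ/(e^x + κ)` for `x ≥ 0`, hence `P[L ≤ x] = 1/(1 + κ e^{-x})` for `x ≥ 0`,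
with an atom at `0` of mass `1/(1+κ)`. -/
theorem distribution_of_max_difference
    {Ω : Type*} [MeasurableSpace Ω] (μ : Measure Ω) [IsProbabilityMeasure μ]
    (κ : ℝ) (hκ : 0 < κ)
    (Y₁ Y₂ : Ω → ℝ)
    (hY₁meas : Measurable Y₁) (hY₂meas : Measurable Y₂)
    (hindep : IndepFun Y₁ Y₂ μ)
    (hY₁dist : ∀ x : ℝ, (μ {ω | Y₁ ω ≤ x}).toReal
      = Real.exp (-Real.exp (-x)) ^ (1 / (1 + κ)))
    (hY₂dist : ∀ x : ℝ, (μ {ω | Y₂ ω ≤ x}).toReal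
      = Real.exp (-Real.exp (-x)) ^ (κ / (1 + κ))) :
    (∀ x : ℝ, 0 ≤ x →
      (μ {ω | x < max (Y₁ ω) (Y₂ ω) - Y₁ ω}).toReal = κ / (Real.exp x + κ)) ∧
    (∀ x : ℝ, 0 ≤ x →
      (μ {ω | max (Y₁ ω) (Y₂ ω) - Y₁ ω ≤ x}).toReal = 1 / (1 + κ * Real.exp (-x))) ∧
    (μ {ω | max (Y₁ ω) (Y₂ ω) - Y₁ ω = 0}).toReal = 1 / (1 + κ) := by
  have key : ∀ x : ℝ, (μ {ω | Y₂ ω ≤ Y₁ ω + x}).toReal = 1 / (1 + κ * Real.exp (-x)) := by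
    intro x
    have hS : MeasurableSet {p : ℝ × ℝ | p.2 ≤ p.1 + x} :=
      measurableSet_le (by fun_prop) (by fun_prop)
    have hprod := (indepFun_iff_map_prod_eq_prod_map_map hY₁meas.aemeasurable
      hY₂meas.aemeasurable).1 hindep
    have : IsProbabilityMeasure (μ.map Y₂) := Measure.isProbabilityMeasure_map hY₂meas.aemeasurable
    have h1 : μ {ω | Y₂ ω ≤ Y₁ ω + x} = ∫⁻ ω, μ {ω' | Y₂ ω' ≤ Y₁ ω + x} ∂μ := by
      have e1 : μ {ω | Y₂ ω ≤ Y₁ ω + x}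
          = (μ.map (fun ω => (Y₁ ω, Y₂ ω))) {p : ℝ × ℝ | p.2 ≤ p.1 + x} := by
        rw [Measure.map_apply (hY₁meas.prodMk hY₂meas) hS]; rfl
      rw [e1, hprod, Measure.prod_apply hS,
        lintegral_map (measurable_measure_prodMk_left hS) hY₁meas]
      refine lintegral_congr fun ω => ?_
      rw [Measure.map_apply hY₂meas (measurable_prodMk_left hS)]; rfl
    have hb : 0 < κ / (1 + κ) * Real.exp (-x) := by positivity
    have h2 : ∀ ω, μ {ω' | Y₂ ω' ≤ Y₁ ω + x} = ENNReal.ofReal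
        (Real.exp (-(κ / (1 + κ) * Real.exp (-x) * Real.exp (-Y₁ ω)))) := by
      intro ω
      rw [← ENNReal.ofReal_toReal (measure_ne_top μ _), hY₂dist, ← Real.exp_mul, neg_add,
        Real.exp_add]
      congr 2
      ring
    simp_rw [h2] at h1
    rw [h1, ← integral_eq_lintegral_of_nonneg_ae
      (Eventually.of_forall fun ω => (Real.exp_pos _).le) (by fun_prop),
      exp_moment_aux μ Y₁ hY₁meas (1 / (1 + κ)) _ (by positivity) hb hY₁dist]
    field_simp
  have hle : ∀ x : ℝ, 0 ≤ x → {ω | max (Y₁ ω) (Y₂ ω) - Y₁ ω ≤ x} = {ω | Y₂ ω ≤ Y₁ ω + x} := by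
    intro x hx
    ext ω
    simp only [Set.mem_ofPred_eq, sub_le_iff_le_add, max_le_iff]
    constructor
    · rintro ⟨_, h⟩; linarith
    · intro h; constructor <;> linarith
  refine ⟨fun x hx => ?_, fun x hx => ?_, ?_⟩
  · have hc : {ω | x < max (Y₁ ω) (Y₂ ω) - Y₁ ω} = {ω | Y₂ ω ≤ Y₁ ω + x}ᶜ := by
      rw [← hle x hx]; ext ω; simp only [Set.mem_ofPred_eq, Set.mem_compl_iff, not_le]
    have hm : MeasurableSet {ω | Y₂ ω ≤ Y₁ ω + x} :=
      measurableSet_le hY₂meas (hY₁meas.add_const x)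
    have h3 := probReal_compl_eq_one_sub (μ := μ) hm
    simp only [Measure.real] at h3
    rw [hc, h3, key, Real.exp_neg]
    have := Real.exp_pos x
    field_simp
    ring
  · rw [hle x hx, key]
  · have h0 : {ω | max (Y₁ ω) (Y₂ ω) - Y₁ ω = 0} = {ω | Y₂ ω ≤ Y₁ ω + 0} := by
      ext ω; simp [sub_eq_zero]
    rw [h0, key]; simp
end
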